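/- arXiv:2501.02249 — 3 statements merged into one kernel-verified Lean document; each statement's English description precedes it below -/
import Mathlib

section
/- Let G be a finite group and N a minimal normal subgroup with N = S_1 × ... × S_t where the S_i are isomorphic nonabelian simple groups. If H is a maximal subgroup of G with G = HN and K = H ∩ N, then either (1) K = K_1 × ... × K_t with K_i a proper subgroup of S_i for each i, and H acts transitively on {K_1,...,K_t}; or (2) K = A_1 × ... × A_k is a minimal normal subgroup of H with each A_i ≅ S_1, k divides t, k < t, and every nonidentity element of each A_i has support of size t/k with respect to the decomposition of N. -/
namespace Stmt4

section Abstract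
variable {K : Type*} [Group K]

lemma simple_inter {S : Type*} [Group S] [IsSimpleGroup S] (hS : ∃ a b : S, a * b ≠ b * a)
    (f : K →* S) (hf : Function.Surjective f) (B C : Subgroup K) (hBn : B.Normal) (hCn : C.Normal)
    (hB : ∃ x ∈ B, f x ≠ 1) (hC : ∃ x ∈ C, f x ≠ 1) (s : S) : ∃ x ∈ B ⊓ C, f x = s := by
  have key : ∀ D : Subgroup K, D.Normal → (∃ x ∈ D, f x ≠ 1) → D.map f = ⊤ := by
    intro D hD ⟨x, hx, hx1⟩
    have hn : (D.map f).Normal := hD.map f hf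
    rcases hn.eq_bot_or_eq_top with h | h
    · exfalso
      have : f x ∈ D.map f := Subgroup.mem_map_of_mem f hx
      rw [h, Subgroup.mem_bot] at this
      exact hx1 this
    · exact h
  have h3 : (B ⊓ C).map f = ⊤ := by
    apply key _ (Subgroup.normal_inf_normal B C)
    obtain ⟨a, b, hab⟩ := hS
    have ha : a ∈ B.map f := by rw [key B hBn hB]; trivial
    have hb : b ∈ C.map f := by rw [key C hCn hC]; trivial
    obtain ⟨x, hx, rfl⟩ := ha
    obtain ⟨y, hy, rfl⟩ := hb
    refine ⟨x * y * x⁻¹ * y⁻¹, ⟨?_, ?_⟩, ?_⟩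
    · have := B.mul_mem hx (hBn.conj_mem _ (B.inv_mem hx) y)
      simpa [mul_assoc] using this
    · exact C.mul_mem (hCn.conj_mem _ hy x) (C.inv_mem hy)
    · intro h
      apply hab
      simp only [map_mul, map_inv] at h
      rw [mul_inv_eq_one, mul_inv_eq_iff_eq_mul] at h
      exact h
  have : s ∈ (B ⊓ C).map f := by rw [h3]; trivial
  exact this

variable {t : ℕ} {S : Fin t → Type*} [∀ i, Group (S i)]

def A (p : ∀ i, K →* S i) (i : Fin t) : Subgroup K :=
  ⨅ j, ⨅ (_ : (p j).ker ≠ (p i).ker), (p j).ker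

lemma A_mem (p : ∀ i, K →* S i) (i : Fin t) (x : K) :
    x ∈ A p i ↔ ∀ j, (p j).ker ≠ (p i).ker → p j x = 1 := by
  simp [A, Subgroup.mem_iInf, MonoidHom.mem_ker]

lemma A_normal (p : ∀ i, K →* S i) (i : Fin t) : (A p i).Normal := by
  constructor
  intro x hx g
  rw [A_mem] at hx ⊢
  intro j hj
  simp [hx j hj]

variable (p : ∀ i, K →* S i) (hs : ∀ i, IsSimpleGroup (S i))
  (hn : ∀ i, ∃ a b : S i, a * b ≠ b * a) (hp : ∀ i, Function.Surjective (p i))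
  (hinj : ∀ x, (∀ i, p i x = 1) → x = 1)

include hs hn hp

lemma exists_of_ker_ne (i j : Fin t) (hij : (p j).ker ≠ (p i).ker) :
    ∃ x ∈ (p j).ker, p i x ≠ 1 := by
  by_contra hcon
  push Not at hcon
  apply hij
  have hle : (p j).ker ≤ (p i).ker := hcon
  have := hs j
  have hnorm : ((p i).ker.map (p j)).Normal := (MonoidHom.normal_ker (p i)).map _ (hp j)
  rcases hnorm.eq_bot_or_eq_top with h | h
  · apply le_antisymm hle
    rwa [Subgroup.map_eq_bot_iff] at h
  · exfalso
    have htop : (p i).ker = ⊤ := by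
      rw [eq_top_iff]
      intro x _
      have hx : p j x ∈ (p i).ker.map (p j) := by rw [h]; trivial
      obtain ⟨y, hy, hyx⟩ := hx
      have : y⁻¹ * x ∈ (p j).ker := by simp [MonoidHom.mem_ker, hyx]
      have := (p i).ker.mul_mem hy (hle this)
      simpa using this
    obtain ⟨a, b, hab⟩ := hn i
    obtain ⟨x, rfl⟩ := hp i a
    obtain ⟨y, rfl⟩ := hp i b
    have hx : x ∈ (p i).ker := by rw [htop]; trivial
    have hy : y ∈ (p i).ker := by rw [htop]; trivial
    rw [MonoidHom.mem_ker] at hx hy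
    simp [hx, hy] at hab

omit hs hp in
lemma exists_ne (i : Fin t) : ∃ s : S i, s ≠ 1 := by
  obtain ⟨a, b, hab⟩ := hn i
  refine ⟨a, ?_⟩
  rintro rfl
  simp at hab

lemma A_surj (i : Fin t) (s : S i) : ∃ x ∈ A p i, p i x = s := by
  have := hs i
  have main : ∀ T : Finset (Fin t), (∀ j ∈ T, (p j).ker ≠ (p i).ker) →
      ∀ s : S i, ∃ x : K, (∀ j ∈ T, p j x = 1) ∧ p i x = s := by
    intro T
    induction T using Finset.induction_on with
    | empty => intro _ s; obtain ⟨x, hx⟩ := hp i s; exact ⟨x, by simp, hx⟩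
    | insert j T hjT ih =>
      intro hT s
      have hT' := ih (fun j hj => hT j (Finset.mem_insert_of_mem hj))
      let B : Subgroup K := ⨅ j ∈ T, (p j).ker
      have hBm : ∀ x, x ∈ B ↔ ∀ j ∈ T, p j x = 1 := by
        intro x; simp [B, Subgroup.mem_iInf, MonoidHom.mem_ker]
      have hBn : B.Normal := by
        constructor
        intro x hx g
        rw [hBm] at hx ⊢
        intro j hj
        simp [hx j hj]
      obtain ⟨s₁, hs₁⟩ := exists_ne hn i
      obtain ⟨x, hx1, hx2⟩ := simple_inter (hn i) (p i) (hp i) B (p j).ker hBn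
        (MonoidHom.normal_ker _)
        (by obtain ⟨x, h1, h2⟩ := hT' s₁; exact ⟨x, (hBm x).2 h1, h2 ▸ hs₁⟩)
        (exists_of_ker_ne p hs hn hp i j (hT j (Finset.mem_insert_self _ _))) s
      refine ⟨x, ?_, hx2⟩
      intro l hl
      rcases Finset.mem_insert.1 hl with rfl | hl
      · exact hx1.2
      · exact (hBm x).1 hx1.1 l hl
  classical
  obtain ⟨x, hx1, hx2⟩ := main (Finset.univ.filter fun j => (p j).ker ≠ (p i).ker) (by simp) s
  refine ⟨x, (A_mem p i x).2 ?_, hx2⟩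
  intro j hj
  exact hx1 j (by simpa using hj)

omit hs hn hp in
include hinj in
lemma A_inj (i j : Fin t) (hij : (p j).ker = (p i).ker) (x : K) (hx : x ∈ A p i)
    (hx1 : p j x = 1) : x = 1 := by
  apply hinj
  intro l
  by_cases h : (p l).ker = (p i).ker
  · rw [← MonoidHom.mem_ker, h, ← hij]; exact hx1
  · exact (A_mem p i x).1 hx l h

include hinj

lemma A_iso (i : Fin t) : Nonempty (A p i ≃* S i) := by
  refine ⟨MulEquiv.ofBijective ((p i).comp (A p i).subtype) ⟨?_, ?_⟩⟩
  · rw [injective_iff_map_eq_one]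
    rintro ⟨x, hx⟩ h
    ext
    exact A_inj p hinj i i rfl x hx h
  · intro s
    obtain ⟨x, hx, h⟩ := A_surj p hs hn hp i s
    exact ⟨⟨x, hx⟩, h⟩

lemma A_sup (Q : Subgroup K) (hQ : ∀ i, A p i ≤ Q) : Q = ⊤ := by
  rw [eq_top_iff]
  intro x _
  have main : ∀ T : Finset (Fin t), ∃ y ∈ Q, ∀ j ∈ T, p j y = p j x := by
    intro T
    induction T using Finset.induction_on with
    | empty => exact ⟨1, Q.one_mem, by simp⟩
    | insert i T hiT ih =>
      obtain ⟨y, hy, hyT⟩ := ih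
      obtain ⟨a, ha, hax⟩ := A_surj p hs hn hp i (p i (y⁻¹ * x))
      have hi : p i (y * a) = p i x := by simp [hax]
      refine ⟨y * a, Q.mul_mem hy (hQ i ha), ?_⟩
      intro j hj
      rcases Finset.mem_insert.1 hj with rfl | hj
      · exact hi
      · by_cases h : (p j).ker = (p i).ker
        · have : (y * a)⁻¹ * x ∈ (p i).ker := by
            rw [MonoidHom.mem_ker, map_mul, map_inv, hi]; simp
          rw [← h, MonoidHom.mem_ker, map_mul, map_inv, inv_mul_eq_one] at this
          exact this
        · rw [map_mul, (A_mem p i a).1 ha j h, mul_one, hyT j hj]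
  obtain ⟨y, hy, h⟩ := main Finset.univ
  have : y⁻¹ * x = 1 := hinj _ (fun i => by simp [h i])
  rw [inv_mul_eq_one] at this
  exact this ▸ hy

lemma A_le (L : Subgroup K) (hL : L.Normal) (i : Fin t) (h : ∃ x ∈ L, p i x ≠ 1) :
    A p i ≤ L := by
  intro a ha
  have := hs i
  obtain ⟨s₁, hs₁⟩ := exists_ne hn i
  obtain ⟨x, hx, hxa⟩ := simple_inter (hn i) (p i) (hp i) L (A p i) hL (A_normal p i) h
    (by obtain ⟨x, h1, h2⟩ := A_surj p hs hn hp i s₁; exact ⟨x, h1, h2 ▸ hs₁⟩) (p i a)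
  have : x⁻¹ * a = 1 := A_inj p hinj i i rfl _ ((A p i).mul_mem ((A p i).inv_mem hx.2) ha)
    (by simp [hxa])
  rw [inv_mul_eq_one] at this
  exact this ▸ hx.1

end Abstract

section Concrete

variable {G : Type*} [Group G] {t : ℕ} {S : Fin t → Subgroup G} {N : Subgroup G}

/-- Coordinate projections of `N` onto the factors `S i`, with the properties we use. -/
structure Dec (S : Fin t → Subgroup G) (N : Subgroup G) (P : ∀ i, N →* S i) : Prop where
  simple : ∀ i, IsSimpleGroup (S i)
  nab : ∀ i, ∃ a b : S i, a * b ≠ b * a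
  iso : ∀ i j, Nonempty (S i ≃* S j)
  le : ∀ i, S i ≤ N
  self : ∀ i (s : G) (hs : s ∈ S i) (hN : s ∈ N), P i ⟨s, hN⟩ = ⟨s, hs⟩
  other : ∀ i j (s : G) (_ : s ∈ S j) (hN : s ∈ N), j ≠ i → P i ⟨s, hN⟩ = 1
  mem : ∀ (Q : Subgroup G) (x : N), (∀ i, (P i x : G) ∈ Q) → (x : G) ∈ Q
  comm : ∀ i (x : N) (s : G), s ∈ S i → Commute ((P i x : G)⁻¹ * x) s

lemma exists_P
    (hsimple : ∀ i, IsSimpleGroup (S i))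
    (hnab : ∀ i, ∃ a b : S i, a * b ≠ b * a)
    (hiso : ∀ i j, Nonempty (S i ≃* S j))
    (hcomm : Pairwise fun i j => ∀ x y : G, x ∈ S i → y ∈ S j → Commute x y)
    (hinj : Function.Injective (Subgroup.noncommPiCoprod hcomm))
    (hrange : (Subgroup.noncommPiCoprod hcomm).range = N) :
    ∃ P : ∀ i, N →* S i, Dec S N P ∧
      ∀ (f : ∀ i, S i) (h : Subgroup.noncommPiCoprod hcomm f ∈ N) (i : Fin t),
        P i ⟨Subgroup.noncommPiCoprod hcomm f, h⟩ = f i := by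
  subst hrange
  let e := MonoidHom.ofInjective hinj
  let P : ∀ i, (Subgroup.noncommPiCoprod hcomm).range →* S i := fun i =>
    (Pi.evalMonoidHom (fun i => S i) i).comp e.symm.toMonoidHom
  have hP : ∀ (f : ∀ i, S i) (h) (i : Fin t),
        P i ⟨Subgroup.noncommPiCoprod hcomm f, h⟩ = f i := by
    intro f h i
    have : e.symm ⟨Subgroup.noncommPiCoprod hcomm f, h⟩ = f := by
      rw [MulEquiv.symm_apply_eq]; rfl
    change e.symm ⟨Subgroup.noncommPiCoprod hcomm f, h⟩ i = f i
    rw [this]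
  have hsing : ∀ i (s : S i), Subgroup.noncommPiCoprod hcomm (Pi.mulSingle i s) = s :=
    fun i s => Subgroup.noncommPiCoprod_mulSingle i s
  refine ⟨P, ⟨hsimple, hnab, hiso, ?_, ?_, ?_, ?_, ?_⟩, hP⟩
  · intro i s hs
    exact ⟨_, hsing i ⟨s, hs⟩⟩
  · intro i s hs hN
    have := hP (Pi.mulSingle i ⟨s, hs⟩) ⟨_, rfl⟩ i
    simpa only [hsing, Pi.mulSingle_eq_same] using this
  · intro i j s hs hN hij
    have := hP (Pi.mulSingle j ⟨s, hs⟩) ⟨_, rfl⟩ i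
    rw [Pi.mulSingle_eq_of_ne hij.symm] at this
    simpa only [hsing] using this
  · rintro Q ⟨x, hx⟩ h
    obtain ⟨f, rfl⟩ := MonoidHom.mem_range.1 hx
    simp only [hP] at h
    change Subgroup.noncommPiCoprod hcomm f ∈ Q
    rw [Subgroup.noncommPiCoprod_apply]
    exact Subgroup.noncommProd_mem _ _ (fun c _ => h c)
  · rintro i ⟨x, hx⟩ s hs
    obtain ⟨f, rfl⟩ := MonoidHom.mem_range.1 hx
    simp only [hP]
    rw [← hsing i (f i), show s = ((⟨s, hs⟩ : S i) : G) from rfl, ← hsing i ⟨s, hs⟩,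
      ← map_inv, ← map_mul]
    apply Commute.map
    rw [commute_iff_eq]
    funext j
    by_cases hj : j = i
    · subst hj; simp
    · simp [Pi.mulSingle_eq_of_ne hj]

variable {P : ∀ i, N →* S i} (D : Dec S N P)
include D

lemma Dec.ext_one (x : N) (h : ∀ i, P i x = 1) : x = 1 := by
  have := D.mem ⊥ x (fun i => by simp [h i])
  exact Subtype.ext (by simpa using this)

lemma Dec.surj (i : Fin t) : Function.Surjective (P i) := by
  rintro ⟨s, hs⟩
  exact ⟨⟨s, D.le i hs⟩, D.self i s hs _⟩

lemma Dec.central (i : Fin t) (z : S i) (hz : ∀ s, z * s = s * z) : z = 1 := by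
  have := D.simple i
  have hc : z ∈ Subgroup.center (S i) := Subgroup.mem_center_iff.2 (fun s => (hz s).symm)
  rcases (inferInstance : (Subgroup.center (S i)).Normal).eq_bot_or_eq_top with h | h
  · rw [h] at hc; simpa using hc
  · exfalso
    obtain ⟨a, b, hab⟩ := D.nab i
    have ha : a ∈ Subgroup.center (S i) := by rw [h]; trivial
    exact hab (Subgroup.mem_center_iff.1 ha b).symm

lemma Dec.equivariant [hN : N.Normal] (g : G) (i j : Fin t)
    (hg : (S i).map (MulAut.conj g).toMonoidHom = S j) (x : N) (y : N)
    (hy : (y : G) = g * x * g⁻¹) : (P j y : G) = g * P i x * g⁻¹ := by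
  have hu : g * P i x * g⁻¹ ∈ S j := by
    rw [← hg]; exact ⟨P i x, (P i x).2, by simp⟩
  let u : N := ⟨g * P i x * g⁻¹, D.le j hu⟩
  have hPu : P j u = ⟨_, hu⟩ := D.self j _ hu _
  have h1 : P j (u⁻¹ * y) = 1 := by
    apply D.central
    rintro ⟨s, hs⟩
    have hs' := hs
    rw [← hg] at hs'
    obtain ⟨r, hr, hrs⟩ := hs'
    have hrs : g * r * g⁻¹ = s := by simpa using hrs
    have hc := D.comm i x r hr
    have h2 : (u⁻¹ * y) * (⟨s, D.le j hs⟩ : N) = ⟨s, D.le j hs⟩ * (u⁻¹ * y) := by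
      apply Subtype.ext
      simp only [Subgroup.coe_mul, Subgroup.coe_inv, u, hy, ← hrs]
      calc _ = g * (((P i x : G)⁻¹ * x) * r) * g⁻¹ := by group
        _ = g * (r * ((P i x : G)⁻¹ * x)) * g⁻¹ := by rw [hc.eq]
        _ = _ := by group
    have h3 := congrArg (P j) h2
    rw [map_mul, map_mul (P j) (⟨s, D.le j hs⟩ : N), D.self j s hs] at h3
    exact h3
  rw [map_mul, map_inv, inv_mul_eq_one, hPu] at h1
  rw [← h1]

lemma Dec.conj_exists [Finite G] [hN : N.Normal] (g : G) (i : Fin t) :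
    ∃ j, (S i).map (MulAut.conj g).toMonoidHom = S j := by
  set T := (S i).map (MulAut.conj g).toMonoidHom with hT
  have hTN : T ≤ N := by
    rintro _ ⟨s, hs, rfl⟩
    simpa using hN.conj_mem s (D.le i hs) g
  have hTn : (T.subgroupOf N).Normal := by
    constructor
    rintro ⟨x, hx⟩ hxT ⟨n, hn⟩
    rw [Subgroup.mem_subgroupOf] at hxT ⊢
    obtain ⟨s, hs, hsx⟩ := hxT
    have hsx : g * s * g⁻¹ = x := by simpa using hsx
    -- conjugation by m in N preserves S i
    let m : N := ⟨g⁻¹ * n * g, by simpa using hN.conj_mem n hn g⁻¹⟩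
    have hc := (D.comm i m s hs).eq
    refine ⟨(P i m : G) * s * (P i m : G)⁻¹,
      (S i).mul_mem ((S i).mul_mem (P i m).2 hs) ((S i).inv_mem (P i m).2), ?_⟩
    have h1 : (P i m : G) * s * (P i m : G)⁻¹ = m * s * (m : G)⁻¹ := by
      have : (m : G) = P i m * ((P i m : G)⁻¹ * m) := by group
      rw [eq_mul_inv_iff_mul_eq]
      calc _ = (P i m : G) * (s * ((P i m : G)⁻¹ * m)) := by group
        _ = (P i m : G) * (((P i m : G)⁻¹ * m) * s) := by rw [hc]
        _ = _ := by group
    rw [h1]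
    simp only [m, ← hsx]
    simp [mul_assoc]
  obtain ⟨a, b, hab⟩ := D.nab i
  have hex : ∃ j, ∃ x ∈ T.subgroupOf N, P j x ≠ 1 := by
    by_contra hcon
    push Not at hcon
    have ha : g * a * g⁻¹ ∈ T := ⟨a, a.2, by simp⟩
    have := D.ext_one ⟨_, hTN ha⟩ (fun j => hcon j _ (by simpa [Subgroup.mem_subgroupOf] using ha))
    have h1 : g * a * g⁻¹ = 1 := congrArg Subtype.val this
    have h2 : (a : G) = 1 := by simpa using h1
    have h3 : a = 1 := Subtype.ext h2
    simp [h3] at hab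
  obtain ⟨j, hj⟩ := hex
  have hle := A_le P D.simple D.nab D.surj D.ext_one _ hTn j hj
  have hST : S j ≤ T := by
    intro s hs
    have : (⟨s, D.le j hs⟩ : N) ∈ A P j := by
      rw [A_mem]
      intro l hl
      exact D.other l j s hs _ (by rintro rfl; exact hl rfl)
    exact hle this
  refine ⟨j, (Subgroup.eq_of_le_of_card_ge hST ?_).symm⟩
  obtain ⟨e⟩ := D.iso i j
  rw [← Nat.card_congr e.toEquiv, hT]
  rw [Nat.card_congr ((S i).equivMapOfInjective (MulAut.conj g).toMonoidHom (MulAut.conj g).injective).toEquiv]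

lemma Dec.comm_ne {i j : Fin t} (hij : i ≠ j) {x y : G} (hx : x ∈ S i) (hy : y ∈ S j) :
    Commute x y := by
  have := D.comm j ⟨x, D.le i hx⟩ y hy
  rw [D.other j i x hx _ hij] at this
  simpa using this

lemma Dec.conj_N (n : G) (hn : n ∈ N) (i : Fin t) :
    (S i).map (MulAut.conj n).toMonoidHom ≤ S i := by
  rintro _ ⟨s, hs, rfl⟩
  let m : N := ⟨n, hn⟩
  have hc := (D.comm i m s hs).eq
  have h1 : (P i m : G) * s * (P i m : G)⁻¹ = n * s * n⁻¹ := by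
    rw [eq_mul_inv_iff_mul_eq]
    calc _ = (P i m : G) * (s * ((P i m : G)⁻¹ * m)) := by simp only [m]; group
      _ = (P i m : G) * (((P i m : G)⁻¹ * m) * s) := by rw [hc]
      _ = _ := by simp only [m]; group
  have : n * s * n⁻¹ ∈ S i := by
    rw [← h1]
    exact (S i).mul_mem ((S i).mul_mem (P i m).2 hs) ((S i).inv_mem (P i m).2)
  simpa using this

lemma Dec.S_inj {i j : Fin t} (h : S i ≤ S j) : i = j := by
  by_contra hij
  obtain ⟨a, b, hab⟩ := D.nab i
  exact hab (Subtype.ext (D.comm_ne hij a.2 (h b.2)).eq)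

lemma Dec.trans [Finite G] [hN : N.Normal]
    (hNmin : ∀ K : Subgroup G, K.Normal → K ≠ ⊥ → K ≤ N → K = N)
    (H : Subgroup G) (hHN : H ⊔ N = ⊤) (i j : Fin t) :
    ∃ h ∈ H, (S i).map (MulAut.conj h).toMonoidHom = S j := by
  have hG : ∃ g, (S i).map (MulAut.conj g).toMonoidHom = S j := by
    by_contra hcon
    push Not at hcon
    have h1 : Subgroup.normalClosure (S i : Set G) ≤ N :=
      Subgroup.normalClosure_le_normal (D.le i)
    have h2 : Subgroup.normalClosure (S i : Set G) ≠ ⊥ := by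
      intro h
      have h3 : S i ≤ ⊥ := h ▸ Subgroup.subset_normalClosure
      obtain ⟨a, b, hab⟩ := D.nab i
      have : a = 1 := Subtype.ext (by simpa using h3 a.2)
      simp [this] at hab
    have h3 := hNmin _ Subgroup.normalClosure_normal h2 h1
    have h4 : Subgroup.normalClosure (S i : Set G) ≤ Subgroup.centralizer (S j : Set G) := by
      rw [Subgroup.normalClosure, Subgroup.closure_le]
      intro x hx
      rw [Group.mem_conjugatesOfSet_iff] at hx
      obtain ⟨a, ha, hax⟩ := hx
      obtain ⟨c, rfl⟩ := isConj_iff.1 hax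
      obtain ⟨l, hl⟩ := D.conj_exists c i
      have hlj : l ≠ j := by rintro rfl; exact hcon c hl
      have hx : c * a * c⁻¹ ∈ S l := by rw [← hl]; exact ⟨a, ha, by simp⟩
      rw [SetLike.mem_coe, Subgroup.mem_centralizer_iff]
      intro y hy
      exact (D.comm_ne hlj hx hy).eq.symm
    rw [h3] at h4
    obtain ⟨a, b, hab⟩ := D.nab j
    exact hab (Subtype.ext (Subgroup.mem_centralizer_iff.1 (h4 (D.le j b.2)) a a.2))
  obtain ⟨g, hg⟩ := hG
  have hgm : g ∈ H ⊔ N := by rw [hHN]; trivial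
  obtain ⟨h, hh, n, hn, rfl⟩ := Subgroup.mem_sup_of_normal_right.1 hgm
  refine ⟨h, hh, ?_⟩
  obtain ⟨l, hl⟩ := D.conj_exists h i
  rw [hl]
  have : S j ≤ S l := by
    rw [← hg, ← hl]
    rintro _ ⟨s, hs, rfl⟩
    exact ⟨n * s * n⁻¹, D.conj_N n hn i ⟨s, hs, by simp⟩, by simp [mul_assoc]⟩
  rw [D.S_inj this]

lemma Dec.caseA [Finite G] [hN : N.Normal]
    (hNmin : ∀ K : Subgroup G, K.Normal → K ≠ ⊥ → K ≤ N → K = N)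
    (H : Subgroup G) (hmax : IsCoatom H) (hHN : H ⊔ N = ⊤)
    (i₀ : Fin t) (hi₀ : ((H.subgroupOf N).map (P i₀)) ≠ ⊤) :
    ∃ K : Fin t → Subgroup G, (∀ i, K i < S i) ∧ H ⊓ N = ⨆ i, K i ∧
      ∀ i j, ∃ h ∈ H, (K i).map (MulAut.conj h).toMonoidHom = K j := by
  let K : Fin t → Subgroup G := fun i => ((H.subgroupOf N).map (P i)).map (S i).subtype
  have hKmem : ∀ i x, x ∈ K i ↔ ∃ y : N, (y : G) ∈ H ∧ (P i y : G) = x := by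
    intro i x
    simp only [K, Subgroup.mem_map, Subgroup.mem_subgroupOf]
    constructor
    · rintro ⟨_, ⟨y, hy, rfl⟩, rfl⟩; exact ⟨y, hy, rfl⟩
    · rintro ⟨y, hy, rfl⟩; exact ⟨_, ⟨y, hy, rfl⟩, rfl⟩
  have hKS : ∀ i, K i ≤ S i := by
    intro i x hx
    obtain ⟨y, _, rfl⟩ := (hKmem i x).1 hx
    exact (P i y).2
  have hKconj : ∀ h ∈ H, ∀ i j, (S i).map (MulAut.conj h).toMonoidHom = S j →
      ∀ x ∈ K i, h * x * h⁻¹ ∈ K j := by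
    intro h hh i j hij x hx
    obtain ⟨y, hy, rfl⟩ := (hKmem i x).1 hx
    rw [hKmem]
    refine ⟨⟨h * y * h⁻¹, hN.conj_mem y y.2 h⟩,
      H.mul_mem (H.mul_mem hh hy) (H.inv_mem hh), ?_⟩
    exact D.equivariant h i j hij y _ rfl
  have hKmap : ∀ h ∈ H, ∀ i j, (S i).map (MulAut.conj h).toMonoidHom = S j →
      (K i).map (MulAut.conj h).toMonoidHom = K j := by
    intro h hh i j hij
    apply le_antisymm
    · rintro _ ⟨x, hx, rfl⟩
      simpa using hKconj h hh i j hij x hx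
    · intro x hx
      have hji : (S j).map (MulAut.conj h⁻¹).toMonoidHom = S i := by
        rw [← hij, Subgroup.map_map]
        ext z
        simp [Subgroup.mem_map, mul_assoc]
      have := hKconj h⁻¹ (H.inv_mem hh) j i hji x hx
      exact ⟨_, this, by simp [mul_assoc]⟩
  have htr : ∀ i j, ∃ h ∈ H, (K i).map (MulAut.conj h).toMonoidHom = K j := by
    intro i j
    obtain ⟨h, hh, hij⟩ := D.trans hNmin H hHN i j
    exact ⟨h, hh, hKmap h hh i j hij⟩
  have hlt₀ : K i₀ ≠ S i₀ := by
    intro h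
    apply hi₀
    rw [eq_top_iff]
    intro s _
    have : (s : G) ∈ K i₀ := by rw [h]; exact s.2
    obtain ⟨y, hy, hys⟩ := (hKmem _ _).1 this
    exact ⟨y, hy, Subtype.ext hys⟩
  have hlt : ∀ i, K i < S i := by
    intro i
    refine lt_of_le_of_ne (hKS i) ?_
    intro h
    apply hlt₀
    obtain ⟨g, hg, hij⟩ := D.trans hNmin H hHN i i₀
    rw [← hKmap g hg i i₀ hij, h, hij]
  have hQ1 : H ⊓ N ≤ ⨆ i, K i := by
    rintro x ⟨hxH, hxN⟩
    refine D.mem _ ⟨x, hxN⟩ (fun i => ?_)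
    exact Subgroup.mem_iSup_of_mem i ((hKmem _ _).2 ⟨⟨x, hxN⟩, hxH, rfl⟩)
  have hQN : (⨆ i, K i) ≤ N := iSup_le fun i => (hKS i).trans (D.le i)
  have hnorm : ∀ h ∈ H, ∀ x ∈ ⨆ i, K i, h * x * h⁻¹ ∈ ⨆ i, K i := by
    intro h hh x hx
    have : (⨆ i, K i) ≤ (⨆ i, K i).comap (MulAut.conj h).toMonoidHom := by
      apply iSup_le
      intro i y hy
      obtain ⟨j, hj⟩ := D.conj_exists h i
      have := Subgroup.mem_iSup_of_mem j (hKconj h hh i j hj y hy)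
      simpa using this
    simpa using this hx
  have hQH : (⨆ i, K i) ≤ H := by
    by_contra hcon
    have htop : H ⊔ (⨆ i, K i) = ⊤ := hmax.2 _ (by
      refine lt_of_le_of_ne le_sup_left ?_
      intro h
      exact hcon (h ▸ le_sup_right))
    have hcoe := Subgroup.coe_mul_of_left_le_normalizer_right H (⨆ i, K i)
      (Subgroup.le_normalizer_iff.2 hnorm)
    have hNQ : N ≤ ⨆ i, K i := by
      intro n hn
      have : n ∈ ((H ⊔ ⨆ i, K i : Subgroup G) : Set G) := by rw [htop]; trivial
      rw [hcoe] at this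
      obtain ⟨h, hh, q, hq, hhq⟩ := Set.mem_mul.1 this
      subst hhq
      refine mul_mem (hQ1 ⟨hh, ?_⟩) hq
      have := N.mul_mem hn (N.inv_mem (hQN hq))
      simpa using this
    have hle : (⨆ i, K i) ≤ (((H.subgroupOf N).map (P i₀)).comap (P i₀)).map N.subtype := by
      apply iSup_le
      intro j x hx
      have hxN := D.le j (hKS j hx)
      refine ⟨⟨x, hxN⟩, ?_, rfl⟩
      rw [SetLike.mem_coe, Subgroup.mem_comap]
      by_cases hj : j = i₀
      · subst hj
        rw [D.self j x (hKS j hx)]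
        obtain ⟨y, hy, hyx⟩ := (hKmem _ _).1 hx
        exact ⟨y, hy, Subtype.ext hyx⟩
      · rw [D.other i₀ j x (hKS j hx) hxN hj]
        exact one_mem _
    apply hi₀
    rw [eq_top_iff]
    intro s _
    obtain ⟨y, hy, hys⟩ := hle (hNQ (D.le i₀ s.2))
    have hys : (y : G) = s := hys
    have : y = ⟨s, D.le i₀ s.2⟩ := Subtype.ext hys
    rw [SetLike.mem_coe, Subgroup.mem_comap, this, D.self i₀ s s.2] at hy
    exact hy
  exact ⟨K, hlt, le_antisymm hQ1 (le_inf hQH hQN), htr⟩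

lemma Dec.caseB [Finite G] [hN : N.Normal] (ht : 0 < t)
    (hNmin : ∀ K : Subgroup G, K.Normal → K ≠ ⊥ → K ≤ N → K = N)
    (H : Subgroup G) (hmax : IsCoatom H) (hHN : H ⊔ N = ⊤)
    (hsurj : ∀ i, ((H.subgroupOf N).map (P i)) = ⊤) :
    ∃ (k : ℕ) (A : Fin k → Subgroup G), k ∣ t ∧ k < t ∧
      (∀ i, Nonempty (A i ≃* S ⟨0, ht⟩)) ∧
      H ⊓ N = ⨆ i, A i ∧
      ((H ⊓ N).subgroupOf H).Normal ∧ H ⊓ N ≠ ⊥ ∧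
      (∀ L : Subgroup G, L ≤ H ⊓ N → (L.subgroupOf H).Normal → L ≠ ⊥ → L = H ⊓ N) ∧
      (∀ i, ∀ x : N, (x : G) ∈ A i → (x : G) ≠ 1 →
          Set.ncard {j : Fin t | P j x ≠ 1} = t / k) := by
  classical
  let p : ∀ i, ↥(H ⊓ N) →* S i := fun i => (P i).comp (Subgroup.inclusion inf_le_right)
  have hpP : ∀ i (x : G) (hx : x ∈ H ⊓ N), p i ⟨x, hx⟩ = P i ⟨x, hx.2⟩ := fun i x hx => rfl
  have hp : ∀ i, Function.Surjective (p i) := by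
    intro i s
    have : s ∈ (H.subgroupOf N).map (P i) := by rw [hsurj i]; trivial
    obtain ⟨y, hy, hys⟩ := this
    exact ⟨⟨y, hy, y.2⟩, hys⟩
  have hinj : ∀ x, (∀ i, p i x = 1) → x = 1 := by
    rintro ⟨x, hx⟩ h
    have := D.ext_one ⟨x, hx.2⟩ h
    have h1 : x = 1 := congrArg Subtype.val this
    exact Subtype.ext h1
  -- conjugation
  have hKconj : ∀ h ∈ H, ∀ x ∈ H ⊓ N, h * x * h⁻¹ ∈ H ⊓ N := fun h hh x hx =>
    ⟨H.mul_mem (H.mul_mem hh hx.1) (H.inv_mem hh), hN.conj_mem x hx.2 h⟩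
  have heq : ∀ h (hh : h ∈ H) i j, (S i).map (MulAut.conj h).toMonoidHom = S j →
      ∀ x (hx : x ∈ H ⊓ N), p j ⟨h * x * h⁻¹, hKconj h hh x hx⟩ = 1 ↔ p i ⟨x, hx⟩ = 1 := by
    intro h hh i j hij x hx
    have := D.equivariant h i j hij ⟨x, hx.2⟩ ⟨h * x * h⁻¹, (hKconj h hh x hx).2⟩ rfl
    rw [hpP, hpP, ← OneMemClass.coe_eq_one, this, ← OneMemClass.coe_eq_one]
    constructor
    · intro h; simpa using h
    · intro h; simp [h]
  let M : Fin t → Subgroup ↥(H ⊓ N) := fun i => (p i).ker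
  have hMle : ∀ h ∈ H, ∀ i j i' j', (S i).map (MulAut.conj h).toMonoidHom = S i' →
      (S j).map (MulAut.conj h).toMonoidHom = S j' → M j = M i → M j' = M i' := by
    intro h hh i j i' j' hi hj hij
    ext ⟨x, hx⟩
    have hh' := H.inv_mem hh
    have hy : h⁻¹ * x * h ∈ H ⊓ N := by simpa using hKconj h⁻¹ hh' x hx
    have hxy : (⟨x, hx⟩ : ↥(H ⊓ N)) = ⟨h * (h⁻¹ * x * h) * h⁻¹, hKconj h hh _ hy⟩ :=
      Subtype.ext (by group)
    have h1 := heq h hh i i' hi _ hy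
    have h2 := heq h hh j j' hj _ hy
    change p j' ⟨x, hx⟩ = 1 ↔ p i' ⟨x, hx⟩ = 1
    rw [hxy, h1, h2]
    change _ ∈ M j ↔ _ ∈ M i
    rw [hij]
  have hcard_le : ∀ i i', (Finset.univ.filter fun j => M j = M i).card ≤
      (Finset.univ.filter fun j => M j = M i').card := by
    intro i i'
    obtain ⟨h, hh, hii⟩ := D.trans hNmin H hHN i i'
    choose σ hσ using D.conj_exists h
    apply Finset.card_le_card_of_injOn σ
    · intro j hj
      have hj : M j = M i := by simpa using hj
      have := hMle h hh i j i' (σ j) hii (hσ j) hj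
      simpa using this
    · intro a _ b _ hab
      have h1 := hσ a
      rw [hab, ← hσ b] at h1
      exact D.S_inj (Subgroup.map_injective (f := (MulAut.conj h).toMonoidHom)
        (MulAut.conj h).injective h1).le
  have hcard : ∀ i i', (Finset.univ.filter fun j => M j = M i).card =
      (Finset.univ.filter fun j => M j = M i').card := fun i i' =>
    le_antisymm (hcard_le i i') (hcard_le i' i)
  let i₀ : Fin t := ⟨0, ht⟩
  obtain ⟨m, hm⟩ : ∃ m, m = (Finset.univ.filter fun j => M j = M i₀).card := ⟨_, rfl⟩
  obtain ⟨I, hI⟩ : ∃ I : Finset (Subgroup ↥(H ⊓ N)), I = Finset.univ.image M := ⟨_, rfl⟩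
  have htk : t = I.card * m := by
    have h1 := Finset.card_eq_sum_card_image M (Finset.univ : Finset (Fin t))
    rw [Finset.card_univ, Fintype.card_fin, ← hI] at h1
    rw [h1]
    rw [Finset.sum_const_nat (m := m)]
    intro b hb
    rw [hI] at hb
    obtain ⟨i, _, rfl⟩ := Finset.mem_image.1 hb
    rw [hm]
    exact hcard i i₀
  have hkpos : 0 < I.card := by
    rcases Nat.eq_zero_or_pos I.card with h | h
    · rw [h] at htk; omega
    · exact h
  have hdiv : t / I.card = m := by
    rw [htk]; exact Nat.mul_div_cancel_left m hkpos
  have hr : ∀ c : Fin I.card, ∃ i, M i = (I.equivFin.symm c : Subgroup ↥(H ⊓ N)) := by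
    intro c
    have hIm : ∀ b ∈ I, ∃ i, M i = b := by
      intro b hb
      rw [hI] at hb
      simpa using hb
    obtain ⟨i, hi⟩ := hIm _ (I.equivFin.symm c).2
    exact ⟨i, by rw [hi]⟩
  choose r hr using hr
  have hr' : ∀ i, ∃ c, M (r c) = M i := by
    intro i
    refine ⟨I.equivFin ⟨M i, by rw [hI]; exact Finset.mem_image_of_mem _ (Finset.mem_univ _)⟩, ?_⟩
    rw [hr]; simp
  have hAeq : ∀ i j, M i = M j → Stmt4.A p i = Stmt4.A p j := by
    intro i j hij
    have hij : (p i).ker = (p j).ker := hij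
    simp only [Stmt4.A, hij]
  have hsupp : ∀ i (x : ↥(H ⊓ N)), x ∈ Stmt4.A p i → x ≠ 1 → ∀ j, p j x ≠ 1 ↔ M j = M i := by
    intro i x hx hx1 j
    constructor
    · intro h
      by_contra hne
      exact h ((A_mem p i x).1 hx j hne)
    · intro h h1
      exact hx1 (A_inj p hinj i j h x hx h1)
  refine ⟨I.card, fun c => (Stmt4.A p (r c)).map (H ⊓ N).subtype, ⟨m, htk⟩, ?_, ?_, ?_, ?_, ?_,
    ?_, ?_⟩
  · -- k < t
    by_contra hcon
    have hm1 : m = 1 := by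
      have h0 : m ≠ 0 := by rintro rfl; simp at htk; omega
      by_contra h1
      have : I.card * 2 ≤ I.card * m := Nat.mul_le_mul_left _ (by omega)
      omega
    have hMinj : ∀ i j, M j = M i → j = i := by
      intro i j hij
      have h1 := hcard i i₀
      rw [← hm, hm1, Finset.card_eq_one] at h1
      obtain ⟨a, ha⟩ := h1
      have e1 : i ∈ (Finset.univ.filter fun j => M j = M i) := by simp
      have e2 : j ∈ (Finset.univ.filter fun j => M j = M i) := by simpa using hij
      rw [ha, Finset.mem_singleton] at e1 e2
      rw [e1, e2]
    have hSH : ∀ i, S i ≤ H := by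
      intro i s hs
      obtain ⟨⟨x, hx⟩, hxA, hxs⟩ := A_surj p D.simple D.nab hp i ⟨s, hs⟩
      have : (⟨x, hx.2⟩ : N)⁻¹ * ⟨s, D.le i hs⟩ = 1 := by
        apply D.ext_one
        intro j
        rw [map_mul, map_inv, ← hpP j x hx]
        by_cases hj : j = i
        · subst hj
          rw [hxs, D.self j s hs]; simp
        · rw [(A_mem p i _).1 hxA j (fun h => hj (hMinj _ _ h)),
            D.other j i s hs _ (Ne.symm hj)]
          simp
      rw [inv_mul_eq_one] at this
      have : x = s := congrArg Subtype.val this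
      exact this ▸ hx.1
    have hNH : N ≤ H := fun x hx => D.mem H ⟨x, hx⟩ (fun i => hSH i (P i _).2)
    rw [sup_eq_left.2 hNH] at hHN
    exact hmax.1 hHN
  · intro c
    obtain ⟨e₁⟩ := A_iso p D.simple D.nab hp hinj (r c)
    obtain ⟨e₂⟩ := D.iso (r c) ⟨0, ht⟩
    exact ⟨(((Stmt4.A p (r c)).equivMapOfInjective (H ⊓ N).subtype
      (Subgroup.subtype_injective _)).symm.trans e₁).trans e₂⟩
  · rw [← Subgroup.map_iSup]
    rw [A_sup p D.simple D.nab hp hinj (⨆ c, Stmt4.A p (r c)) ?_]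
    · rw [← MonoidHom.range_eq_map, Subgroup.range_subtype]
    · intro i
      obtain ⟨c, hc⟩ := hr' i
      rw [← hAeq _ _ hc]
      exact le_iSup (fun c => Stmt4.A p (r c)) c
  · constructor
    rintro ⟨x, hxH⟩ hx ⟨h, hh⟩
    rw [Subgroup.mem_subgroupOf] at hx ⊢
    exact hKconj h hh x hx
  · intro h
    obtain ⟨s, hs⟩ := exists_ne D.nab i₀
    obtain ⟨⟨x, hx⟩, hxs⟩ := hp i₀ s
    have hx1 : x = 1 := by rw [h] at hx; simpa using hx
    subst hx1
    apply hs
    rw [← hxs]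
    exact map_one (p i₀)
  · intro L hLK hLn hL
    have hLconj : ∀ h ∈ H, ∀ x ∈ L, h * x * h⁻¹ ∈ L := by
      intro h hh x hx
      have := hLn.conj_mem ⟨x, (hLK hx).1⟩ hx ⟨h, hh⟩
      exact this
    have hLn' : (L.subgroupOf (H ⊓ N)).Normal := by
      constructor
      rintro ⟨x, hxK⟩ hx ⟨h, hh⟩
      exact hLconj h hh.1 x hx
    obtain ⟨x, hxL, hx1⟩ := (Subgroup.bot_or_exists_ne_one L).resolve_left hL
    have hex : ∃ i, p i ⟨x, hLK hxL⟩ ≠ 1 := by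
      by_contra hcon
      push Not at hcon
      exact hx1 (congrArg Subtype.val (hinj _ hcon))
    obtain ⟨i, hi⟩ := hex
    have htop := A_sup p D.simple D.nab hp hinj (L.subgroupOf (H ⊓ N)) (by
      intro j
      apply A_le p D.simple D.nab hp hinj _ hLn' j
      obtain ⟨h, hh, hij⟩ := D.trans hNmin H hHN i j
      refine ⟨⟨h * x * h⁻¹, hKconj h hh x (hLK hxL)⟩, hLconj h hh x hxL, ?_⟩
      rw [Ne, heq h hh i j hij x (hLK hxL)]
      exact hi)
    exact le_antisymm hLK (Subgroup.subgroupOf_eq_top.1 htop)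
  · rintro c x hx hx1
    obtain ⟨y, hy, hyx⟩ := hx
    have hyx : (y : G) = x := hyx
    have hxy : x = ⟨y, y.2.2⟩ := Subtype.ext hyx.symm
    have hy1 : y ≠ 1 := by
      rintro rfl
      exact hx1 hyx.symm
    rw [hdiv, hm, ← hcard (r c) i₀]
    rw [← Set.ncard_coe_finset]
    congr 1
    ext j
    have := hsupp (r c) y hy hy1 j
    simp only [Set.mem_ofPred_eq, Finset.coe_filter, Finset.mem_univ, true_and]
    rw [← this, hxy]
    rfl

end Concrete
end Stmt4


theorem stmt_4 {G : Type*} [Group G] [Finite G] (t : ℕ) (ht : 0 < t)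
    (S : Fin t → Subgroup G)
    (hsimple : ∀ i, IsSimpleGroup (S i))
    (hnab : ∀ i, ∃ a b : S i, a * b ≠ b * a)
    (hiso : ∀ i j, Nonempty (S i ≃* S j))
    (hcomm : Pairwise fun i j => ∀ x y : G, x ∈ S i → y ∈ S j → Commute x y)
    (hinj : Function.Injective (Subgroup.noncommPiCoprod hcomm))
    (N : Subgroup G) (hrange : (Subgroup.noncommPiCoprod hcomm).range = N)
    (hNnormal : N.Normal) (hNbot : N ≠ ⊥)
    (hNmin : ∀ K : Subgroup G, K.Normal → K ≠ ⊥ → K ≤ N → K = N)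
    (H : Subgroup G) (hmax : IsCoatom H) (hHN : H ⊔ N = ⊤) :
    -- (1) `K = K₁ × ⋯ × K_t` with `K i < S i`, and `H` permutes the `K i` transitively
    (∃ K : Fin t → Subgroup G, (∀ i, K i < S i) ∧ H ⊓ N = ⨆ i, K i ∧
      ∀ i j, ∃ h ∈ H, (K i).map (MulAut.conj h).toMonoidHom = K j) ∨
    -- (2) `K = A₁ × ⋯ × A_k` is minimal normal in `H`, with each `A i ≅ S 0`,
    --     `k ∣ t`, `k < t`, and nonidentity elements of each `A i` have support `t / k`
    (∃ (k : ℕ) (A : Fin k → Subgroup G), k ∣ t ∧ k < t ∧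
      (∀ i, Nonempty (A i ≃* S ⟨0, ht⟩)) ∧
      H ⊓ N = ⨆ i, A i ∧
      ((H ⊓ N).subgroupOf H).Normal ∧ H ⊓ N ≠ ⊥ ∧
      (∀ L : Subgroup G, L ≤ H ⊓ N → (L.subgroupOf H).Normal → L ≠ ⊥ → L = H ⊓ N) ∧
      (∀ i, ∀ f : ∀ j, S j, Subgroup.noncommPiCoprod hcomm f ∈ A i →
        Subgroup.noncommPiCoprod hcomm f ≠ 1 →
          Set.ncard {j : Fin t | f j ≠ 1} = t / k)) := by
  obtain ⟨P, D, hP⟩ := Stmt4.exists_P hsimple hnab hiso hcomm hinj hrange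
  by_cases hc : ∀ i, ((H.subgroupOf N).map (P i)) = ⊤
  · right
    obtain ⟨k, A, h1, h2, h3, h4, h5, h6, h7, h8⟩ := D.caseB ht hNmin H hmax hHN hc
    refine ⟨k, A, h1, h2, h3, h4, h5, h6, h7, ?_⟩
    intro i f hf hf1
    have hfN : Subgroup.noncommPiCoprod hcomm f ∈ N := hrange ▸ ⟨f, rfl⟩
    have := h8 i ⟨_, hfN⟩ hf hf1
    simpa only [hP] using this
  · left
    push Not at hc
    obtain ⟨i, hi⟩ := hc
    exact D.caseA hNmin H hmax hHN i hi
end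

section
/- The Mathieu group M_10 ≅ Alt(6).2 has a minimal normal subgroup isomorphic to Alt(6) which is also a maximal subgroup, and every maximal subgroup of M_10 other than this copy of Alt(6) is 2-nilpotent. -/
open Equiv

/-- The 11-cycle `(1,2,...,11)` (0-indexed: `(0,1,...,10)`). -/
def m11a : Equiv.Perm (Fin 11) := finRotate 11

/-- The permutation `(3,7,11,8)(4,10,5,6)` in 1-indexed notation, i.e.
`(2,6,10,7)(3,9,4,5)` on `Fin 11`. -/
def m11b : Equiv.Perm (Fin 11) :=
  (swap (2 : Fin 11) 6 * swap (6 : Fin 11) 10 * swap (10 : Fin 11) 7) *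
  (swap (3 : Fin 11) 9 * swap (9 : Fin 11) 4 * swap (4 : Fin 11) 5)

/-- The Mathieu group `M₁₁`, as the subgroup of `Sym(11)` generated by its
standard generators. -/
def M11 : Subgroup (Equiv.Perm (Fin 11)) := Subgroup.closure {m11a, m11b}

/-- The Mathieu group `M₁₀ ≅ Alt(6).2`, the stabilizer in `M₁₁` of the point `11`
(0-indexed: `10`). -/
def M10 : Subgroup (Equiv.Perm (Fin 11)) :=
  M11 ⊓ MulAction.stabilizer (Equiv.Perm (Fin 11)) (10 : Fin 11)

/-- A group is `2`-nilpotent if it has a normal `2`-complement. -/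
def IsPNilpotent (p : ℕ) (G : Type*) [Group G] : Prop :=
  ∃ N : Subgroup G, N.Normal ∧ ∀ P : Sylow p G, Subgroup.IsComplement' N P


namespace M10aux

/-- Block tables: the `i`-th bipartition of `Fin 6` (the trivial one for `i = 10`). -/
def blk : Fin 11 → Fin 6 → Bool :=
  ![![true, true, false, true, false, false],
    ![true, false, true, true, false, false],
    ![true, true, false, false, false, true],
    ![true, false, false, true, true, false],
    ![true, false, true, false, true, false],
    ![true, true, false, false, true, false],
    ![true, false, false, true, false, true],
    ![true, false, false, false, true, true],
    ![true, false, true, false, false, true],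
    ![true, true, true, false, false, false],
    ![true, true, true, true, true, true]]

/-- `a` and `b` lie in the same block of the `i`-th bipartition. -/
def R (i : Fin 11) (a b : Fin 6) : Bool := blk i a == blk i b

def g1 : Perm (Fin 6) := ⟨![1, 2, 0, 3, 4, 5], ![2, 0, 1, 3, 4, 5], by decide, by decide⟩

def g2 : Perm (Fin 6) := ⟨![0, 2, 3, 4, 5, 1], ![0, 5, 1, 2, 3, 4], by decide, by decide⟩

def k1 : Perm (Fin 6) := ⟨![5, 4, 1, 0, 2, 3], ![3, 2, 4, 5, 1, 0], by decide, by decide⟩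

def k2 : Perm (Fin 6) := ⟨![1, 5, 2, 0, 3, 4], ![3, 0, 2, 4, 5, 1], by decide, by decide⟩

def tt : Perm (Fin 6) := ⟨![0, 3, 2, 1, 5, 4], ![0, 3, 2, 1, 5, 4], by decide, by decide⟩

def t : Perm (Fin 11) := ⟨![0, 5, 8, 4, 2, 9, 1, 7, 3, 6, 10], ![0, 6, 4, 8, 3, 1, 9, 7, 2, 5, 10], by decide, by decide⟩

def jv : Fin 11 → ℕ := ![8, 1, 2, 7, 10, 6, 4, 0, 3, 9, 5]

def ev : Fin 11 → Bool := ![false, true, true, false, true, true, true, false, false, false, true]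

def gv : Fin 11 → Perm (Fin 6) := ![
  ⟨![1, 2, 3, 5, 4, 0], ![5, 0, 1, 2, 4, 3], by decide, by decide⟩,
  ⟨![0, 1, 2, 3, 4, 5], ![0, 1, 2, 3, 4, 5], by decide, by decide⟩,
  ⟨![3, 1, 0, 5, 2, 4], ![2, 1, 4, 0, 5, 3], by decide, by decide⟩,
  ⟨![3, 2, 5, 4, 0, 1], ![4, 5, 1, 0, 3, 2], by decide, by decide⟩,
  ⟨![5, 3, 2, 0, 1, 4], ![3, 4, 2, 1, 5, 0], by decide, by decide⟩,
  ⟨![2, 0, 3, 5, 4, 1], ![1, 5, 0, 2, 4, 3], by decide, by decide⟩,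
  ⟨![1, 2, 3, 4, 0, 5], ![4, 0, 1, 2, 3, 5], by decide, by decide⟩,
  ⟨![5, 1, 2, 0, 4, 3], ![3, 1, 2, 5, 4, 0], by decide, by decide⟩,
  ⟨![4, 0, 5, 1, 3, 2], ![1, 3, 5, 4, 0, 2], by decide, by decide⟩,
  ⟨![2, 4, 0, 1, 5, 3], ![2, 3, 0, 5, 1, 4], by decide, by decide⟩,
  ⟨![4, 2, 5, 3, 1, 0], ![5, 4, 1, 3, 0, 2], by decide, by decide⟩]

def wordsA : List (List (Bool)) := [
  [true, true, false, true, false],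
  [true, false, true, false, true],
  [false, true, false, true, true],
  [true, true, false, true, true, false],
  [true, false, true, true, false, true],
  [true, false, true, false, true, false],
  [false, true, true, false, true, true],
  [false, true, false, true, false, true],
  [true, true, false, false, true, false, false],
  [true, false, false, true, false, false, true],
  [false, false, true, false, false, true, true],
  [true, false, false, true, true, false, false, true],
  [true, false, true, false, true, false, false, true, false, false],
  [true, false, false, true, false, false, true, false, true, false],
  [false, true, false, true, false, false, true, false, false, true],
  [false, false, true, false, false, true, false, true, false, true],
  [false, true, true, false, true, true, false, false, true, true, false, false],
  [false, false, true, true, false, false, true, true, false, true, true, false],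
  [true, true, false, true, false, true, false, false, true, false, false, true, true],
  [true, true, false, false, true, false, false, true, false, true, false, true, true],
  [true, true, false, true, true, false, true, true, false, false, true, true, false, false, true],
  [true, true, false, false, true, true, false, false, true, true, false, true, true, false, true],
  [true, false, true, true, false, true, true, false, false, true, true, false, false, true, true],
  [true, false, false, true, true, false, false, true, true, false, true, true, false, true, true]]

def wordsB : List (List (Bool)) := [
  [true],
  [true, true],
  [false, false, false, true, false, true],
  [false, true, false, false, false, true],
  [false, false, true, false, true, false],
  [true, false, false, false, true, false],
  [false, false, false, false, true, false],
  [false, true, false, true, false, false],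
  [false, false, false, true, false, false],
  [true, false, true, false, false, false],
  [false, false, true, false, false, false],
  [false, true, false, false, false, false],
  [false, false, true, false, true, false, true],
  [false, true, false, false, true, false, true],
  [false, false, false, false, true, false, true],
  [false, true, false, true, false, false, true],
  [false, true, false, false, false, false, true],
  [false, false, false, false, true, true, false],
  [false, false, false, true, false, true, false],
  [true, false, true, false, false, true, false],
  [false, false, true, false, true, false, false],
  [false, true, false, true, false, false, false],
  [true, false, true, false, false, false, false],
  [false, true, false, false, true, false, true, true],
  [false, false, true, false, true, true, false, true],
  [true, false, true, false, false, true, false, true],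
  [false, true, true, false, true, false, false, true],
  [false, true, false, true, true, false, true, false],
  [true, true, false, true, false, false, true, false],
  [true, false, true, true, false, true, false, false],
  [false, false, false, false, true, true, false, true, true],
  [true, true, false, false, false, true, false, true, true],
  [true, true, false, true, false, false, false, true, true],
  [true, false, false, true, false, false, false, true, true],
  [true, false, true, false, false, false, false, true, true],
  [true, true, false, false, false, true, false, false, true],
  [false, false, false, true, false, true, true, false, true, false],
  [false, true, false, true, true, false, true, false, false, false],
  [false, false, false, true, false, true, true, false, false, true, true],
  [false, true, true, false, false, true, false, false, true, true, false]]

/-- The nine elements of the Sylow 3-subgroup containing `g1`. -/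
def q9v : Fin 9 → Perm (Fin 6) := ![
  ⟨![0, 1, 2, 3, 4, 5], ![0, 1, 2, 3, 4, 5], by decide, by decide⟩,
  ⟨![0, 1, 2, 4, 5, 3], ![0, 1, 2, 5, 3, 4], by decide, by decide⟩,
  ⟨![0, 1, 2, 5, 3, 4], ![0, 1, 2, 4, 5, 3], by decide, by decide⟩,
  ⟨![1, 2, 0, 3, 4, 5], ![2, 0, 1, 3, 4, 5], by decide, by decide⟩,
  ⟨![1, 2, 0, 4, 5, 3], ![2, 0, 1, 5, 3, 4], by decide, by decide⟩,
  ⟨![1, 2, 0, 5, 3, 4], ![2, 0, 1, 4, 5, 3], by decide, by decide⟩,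
  ⟨![2, 0, 1, 3, 4, 5], ![1, 2, 0, 3, 4, 5], by decide, by decide⟩,
  ⟨![2, 0, 1, 4, 5, 3], ![1, 2, 0, 5, 3, 4], by decide, by decide⟩,
  ⟨![2, 0, 1, 5, 3, 4], ![1, 2, 0, 4, 5, 3], by decide, by decide⟩]

/-- Product of a word in two elements (letter `true` is `x`, letter `false` is `y`). -/
def wd {G : Type*} [Group G] (x y : G) : List Bool → G
  | [] => 1
  | true :: l => x * wd x y l
  | false :: l => y * wd x y l

/-- Evaluation of a word of functions at a point. -/
def wp {α : Type*} (x y : α → α) : List Bool → α → α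
  | [], i => i
  | true :: l, i => x (wp x y l i)
  | false :: l, i => y (wp x y l i)

theorem wd_apply {α : Type*} (x y : Perm α) (l : List Bool) (i : α) :
    wd x y l i = wp x y l i := by
  induction l with
  | nil => rfl
  | cons k l ih => cases k <;> simp [wd, wp, ih]

theorem wd_mem {G : Type*} [Group G] (K : Subgroup G) {x y : G} (hx : x ∈ K) (hy : y ∈ K)
    (l : List Bool) : wd x y l ∈ K := by
  induction l with
  | nil => exact K.one_mem
  | cons k l ih =>
    cases k
    · exact K.mul_mem hy ih
    · exact K.mul_mem hx ih

theorem R_inj : ∀ i j : Fin 11, (∀ a b, R i a b = R j a b) → i = j := by decide +kernel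

theorem R_swap : ∀ k : Fin 5, ∀ i, ∃ j, ∀ a b,
    R j (swap k.castSucc k.succ a) (swap k.castSucc k.succ b) = R i a b := by
  decide +kernel

/-- Reduction of statements about permutations of `Fin 6` to tuples of distinct values. -/
theorem forall_perm {P : (Fin 6 → Fin 6) → Prop}
    (h : ∀ a b, b ≠ a → ∀ c, c ≠ a → c ≠ b → ∀ d, d ≠ a → d ≠ b → d ≠ c →
      ∀ e, e ≠ a → e ≠ b → e ≠ c → e ≠ d →
      ∀ f, f ≠ a → f ≠ b → f ≠ c → f ≠ d → f ≠ e → P ![a, b, c, d, e, f])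
    (y : Perm (Fin 6)) : P y := by
  have hy : (y : Fin 6 → Fin 6) = ![y 0, y 1, y 2, y 3, y 4, y 5] := by
    ext i; fin_cases i <;> rfl
  have hne : ∀ i j : Fin 6, i ≠ j → y i ≠ y j := fun i j hij => y.injective.ne hij
  rw [hy]
  apply h <;> exact hne _ _ (by decide)

theorem words_A : ∀ y : Perm (Fin 6), (∀ i, y i ≠ i) → (∀ i, y (y (y i)) = i) →
    (∀ i, g1 (y i) = y (g1 i)) ∨ ∃ w ∈ wordsA, ∀ i, wp g1 y w i = g2 i := by
  apply forall_perm (P := fun y => (∀ i, y i ≠ i) → (∀ i, y (y (y i)) = i) →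
    (∀ i, g1 (y i) = y (g1 i)) ∨ ∃ w ∈ wordsA, ∀ i, wp g1 y w i = g2 i)
  decide +kernel

theorem words_B : ∀ a b c : Fin 6, a ≠ b → a ≠ c → b ≠ c →
    ∃ w ∈ wordsB, ∀ i, wp g1 g2 w i = swap a b (swap a c i) := by
  decide +kernel

theorem step_b : ∀ i p : Fin 11, ∀ a b, R (((m11a ^ jv i)⁻¹ * m11b * m11a ^ (i : ℕ) *
    (if ev i then t⁻¹ else 1)) p) (gv i a) (gv i b) = R p a b := by
  decide +kernel

theorem sign_gv : ∀ i, Perm.sign (gv i) = 1 := by decide +kernel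

set_option synthInstance.maxHeartbeats 400000 in
set_option synthInstance.maxSize 2000 in
theorem psi_inj_aux : ∀ g : Perm (Fin 6), (∀ i a b, R i (g a) (g b) = R i a b) →
    ∀ i, g i = i := by
  apply forall_perm (P := fun g => (∀ i a b, R i (g a) (g b) = R i a b) → ∀ i, g i = i)
  decide +kernel


def g3 : Perm (Fin 6) := ⟨![0, 1, 2, 4, 5, 3], ![0, 1, 2, 5, 3, 4], by decide, by decide⟩

theorem q9_form : ∀ k, ∃ p : Fin 3 × Fin 3, q9v k = g1 ^ (p.1 : ℕ) * g3 ^ (p.2 : ℕ) := by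
  decide +kernel

theorem q9_inj : Function.Injective q9v := by
  unfold Function.Injective; decide +kernel

theorem q9_mul : ∀ k l, ∃ m, q9v m = q9v k * q9v l := by decide +kernel

theorem q9_inv : ∀ k, ∃ m, q9v m = (q9v k)⁻¹ := by decide +kernel

theorem q9_one : ∃ m, q9v m = 1 := by decide +kernel

theorem q9_cube : ∀ k, q9v k ^ 3 = 1 := by decide +kernel

set_option synthInstance.maxHeartbeats 400000 in
set_option synthInstance.maxSize 2000 in
theorem mem_q9_aux : ∀ h : Perm (Fin 6), (∀ i, h (h (h i)) = i) → (∀ i, g1 (h i) = h (g1 i)) →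
    ∃ k, ∀ i, q9v k i = h i := by
  apply forall_perm (P := fun h => (∀ i, h (h (h i)) = i) → (∀ i, g1 (h i) = h (g1 i)) →
    ∃ k, ∀ i, q9v k i = h i)
  decide +kernel

theorem g3_mem_aux : ∀ k, (∀ i, q9v k i ≠ i) →
    ∃ p : Fin 3 × Fin 3, g3 = g1 ^ (p.1 : ℕ) * q9v k ^ (p.2 : ℕ) := by decide +kernel

set_option synthInstance.maxHeartbeats 400000 in
set_option synthInstance.maxSize 2000 in
theorem five_aux : ∀ g : Perm (Fin 6), (∀ i, g (g (g (g (g i)))) = i) →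
    (∃ k, ∀ i, g (g1 i) = q9v k (g i)) → ∀ i, g i = i := by
  apply forall_perm (P := fun g => (∀ i, g (g (g (g (g i)))) = i) →
    (∃ k, ∀ i, g (g1 i) = q9v k (g i)) → ∀ i, g i = i)
  decide +kernel

/-- The Sylow 3-subgroup containing `g1`. -/
def Q9 : Subgroup (Perm (Fin 6)) where
  carrier := Set.range q9v
  mul_mem' := by
    rintro _ _ ⟨k, rfl⟩ ⟨l, rfl⟩
    exact q9_mul k l
  one_mem' := q9_one
  inv_mem' := by
    rintro _ ⟨k, rfl⟩
    exact q9_inv k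

theorem mem_q9 (h : Perm (Fin 6)) (h1 : ∀ i, h (h (h i)) = i) (h2 : ∀ i, g1 (h i) = h (g1 i)) :
    h ∈ Q9 := by
  obtain ⟨k, hk⟩ := mem_q9_aux h h1 h2
  exact ⟨k, Equiv.ext hk⟩

theorem g1_three : g1.IsThreeCycle := by
  rw [← card_support_eq_three_iff]; decide +kernel

/-- Fixed-point-free elements of order 3. -/
def T33 (y : Perm (Fin 6)) : Prop := (∀ i, y i ≠ i) ∧ y ^ 3 = 1

theorem T33.conj {y : Perm (Fin 6)} (h : T33 y) (c : Perm (Fin 6)) : T33 (c * y * c⁻¹) := by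
  refine ⟨fun i hi => h.1 (c⁻¹ i) ?_, ?_⟩
  · have : c (y (c⁻¹ i)) = i := hi
    rw [Equiv.Perm.eq_inv_iff_eq]; exact this
  · rw [conj_pow, h.2]; simp

theorem cube_apply {y : Perm (Fin 6)} (h : y ^ 3 = 1) (i : Fin 6) : y (y (y i)) = i := by
  have := congrArg (fun f : Perm (Fin 6) => f i) h
  simpa [pow_succ] using this

theorem three_conj {x : Perm (Fin 6)} (h : x.IsThreeCycle) : ∃ c, c * x * c⁻¹ = g1 :=
  isConj_iff.1 (Perm.isConj_iff_cycleType_eq.2 (h.trans g1_three.symm))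

theorem three_conj' {x : Perm (Fin 6)} (h : x.IsThreeCycle) :
    ∃ c ∈ alternatingGroup (Fin 6), c * x * c⁻¹ = g1 := by
  obtain ⟨c, hc⟩ := three_conj h
  rcases Int.units_eq_one_or (Perm.sign c) with h1 | h1
  · exact ⟨c, h1, hc⟩
  · refine ⟨swap 3 4 * c, ?_, ?_⟩
    · rw [Perm.mem_alternatingGroup, Perm.sign_mul, h1, Perm.sign_swap (by decide)]; rfl
    · have : swap 3 4 * g1 * (swap 3 4)⁻¹ = g1 := by decide +kernel
      rw [← hc] at this ⊢
      rw [← this]; group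

theorem T33.cycleType {y : Perm (Fin 6)} (h : T33 y) : y.cycleType = {3, 3} := by
  have : Fact (Nat.Prime 3) := ⟨by norm_num⟩
  have h1 := Perm.cycleType_of_pow_prime_eq_one h.2
  have h2 := y.sum_cycleType
  have h3 : y.support = Finset.univ := by ext i; simp [h.1 i]
  rw [h3] at h2
  rw [h1, Multiset.sum_replicate] at h2
  have : Multiset.card y.cycleType = 2 := by simp at h2; omega
  rw [h1, this]; rfl

theorem k1_T33 : T33 k1 := by
  refine ⟨by decide +kernel, by decide +kernel⟩

theorem T33_conj' {y : Perm (Fin 6)} (h : T33 y) :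
    ∃ c ∈ alternatingGroup (Fin 6), c * y * c⁻¹ = k1 := by
  obtain ⟨c, hc⟩ := isConj_iff.1
    (Perm.isConj_iff_cycleType_eq.2 (h.cycleType.trans k1_T33.cycleType.symm))
  rcases Int.units_eq_one_or (Perm.sign c) with h1 | h1
  · exact ⟨c, h1, hc⟩
  · refine ⟨(swap 0 1 * swap 4 5 * swap 2 3) * c, ?_, ?_⟩
    · rw [Perm.mem_alternatingGroup, Perm.sign_mul, h1]; decide +kernel
    · have : (swap 0 1 * swap 4 5 * swap 2 3) * k1 * (swap 0 1 * swap 4 5 * swap 2 3)⁻¹ = k1 := by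
        decide +kernel
      rw [← hc] at this ⊢
      rw [← this]; group

theorem order_three {x : Perm (Fin 6)} (h : x ^ 3 = 1) (h1 : x ≠ 1) :
    x.IsThreeCycle ∨ T33 x := by
  have : Fact (Nat.Prime 3) := ⟨by norm_num⟩
  have h2 := Perm.cycleType_of_pow_prime_eq_one h
  have h3 := x.sum_cycleType
  rw [h2, Multiset.sum_replicate] at h3
  have h4 : x.support.card ≤ 6 := by simpa using Finset.card_le_univ x.support
  have h5 : Multiset.card x.cycleType ≠ 0 := by simpa [Perm.cycleType_eq_zero] using h1
  have h6 : Multiset.card x.cycleType = 1 ∨ Multiset.card x.cycleType = 2 := by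
    simp at h3; omega
  rcases h6 with h6 | h6
  · left
    rw [Perm.IsThreeCycle, h2, h6]; rfl
  · right
    refine ⟨fun i => ?_, h⟩
    rw [h6] at h3
    have : x.support = Finset.univ := by
      apply Finset.eq_univ_of_card; simp at h3 ⊢; omega
    rw [← Perm.mem_support, this]; exact Finset.mem_univ i

theorem alt_le {K : Subgroup (Perm (Fin 6))} (h1 : g1 ∈ K) (h2 : g2 ∈ K) :
    alternatingGroup (Fin 6) ≤ K := by
  rw [← Perm.closure_three_cycles_eq_alternating, Subgroup.closure_le]
  intro x hx
  obtain ⟨a, b, c, hab, hac, hbc, rfl⟩ : ∃ a b c, a ≠ b ∧ a ≠ c ∧ b ≠ c ∧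
      x = swap a b * swap a c := by
    have hx3 : x.IsThreeCycle := hx
    obtain ⟨a, ha⟩ : ∃ a, a ∈ x.support :=
      Finset.card_pos.1 (by rw [hx3.card_support]; norm_num)
    have h1 := hx3.nodup_iff_mem_support.2 ha
    have h2 := hx3.eq_swap_mul_swap_iff_mem_support.2 ha
    rw [swap_comm a] at h2
    simp only [List.nodup_cons, List.mem_cons, List.not_mem_nil, or_false, not_or] at h1
    exact ⟨x a, a, x (x a), fun h => h1.1.1 h.symm, h1.2.1, h1.1.2, h2⟩
  obtain ⟨w, -, hw⟩ := words_B a b c hab hac hbc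
  rw [← show wd g1 g2 w = swap a b * swap a c from Equiv.ext fun i => (wd_apply _ _ w i).trans (hw i)]
  exact wd_mem K h1 h2 w

theorem alt_le_or {K : Subgroup (Perm (Fin 6))} {y : Perm (Fin 6)} (h1 : g1 ∈ K) (hy : y ∈ K)
    (hT : T33 y) : g1 * y = y * g1 ∨ alternatingGroup (Fin 6) ≤ K := by
  rcases words_A y hT.1 (cube_apply hT.2) with h | ⟨w, -, hw⟩
  · exact Or.inl (Equiv.ext h)
  · refine Or.inr (alt_le h1 ?_)
    rw [← show wd g1 y w = g2 from Equiv.ext fun i => (wd_apply _ _ w i).trans (hw i)]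
    exact wd_mem K h1 hy w

theorem alt_le_conj {K : Subgroup (Perm (Fin 6))} {c : Perm (Fin 6)}
    (h : alternatingGroup (Fin 6) ≤ K.map (MulAut.conj c).toMonoidHom) :
    alternatingGroup (Fin 6) ≤ K := by
  intro x hx
  have : c * x * c⁻¹ ∈ alternatingGroup (Fin 6) := by
    rw [Perm.mem_alternatingGroup] at hx ⊢
    simp [hx]
  obtain ⟨z, hz, hz'⟩ := h this
  have : z = x := by simpa using hz'
  exact this ▸ hz

theorem alt_le_or' {K : Subgroup (Perm (Fin 6))} {x y : Perm (Fin 6)} (hx : x ∈ K) (hy : y ∈ K)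
    (h3 : x.IsThreeCycle) (hT : T33 y) : x * y = y * x ∨ alternatingGroup (Fin 6) ≤ K := by
  obtain ⟨c, hc⟩ := three_conj h3
  rcases alt_le_or (K := K.map (MulAut.conj c).toMonoidHom) (y := c * y * c⁻¹)
    ⟨x, hx, by simpa using hc⟩ ⟨y, hy, by simp⟩ (hT.conj c) with h | h
  · left
    rw [← hc] at h
    have h' : c * (x * y) * c⁻¹ = c * (y * x) * c⁻¹ := by
      calc _ = c * x * c⁻¹ * (c * y * c⁻¹) := by group
        _ = _ := h
        _ = _ := by group
    simpa using h'
  · exact Or.inr (alt_le_conj h)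

theorem lemmaA0 {K : Subgroup (Perm (Fin 6))} (hK : ¬ alternatingGroup (Fin 6) ≤ K)
    {y : Perm (Fin 6)} (hx : g1 ∈ K) (hy : y ∈ K) (hT : T33 y) :
    ∃ Q : Subgroup (Perm (Fin 6)), Nat.card Q = 9 ∧ (∀ h, h ∈ Q ↔ h ∈ K ∧ h ^ 3 = 1) ∧
      ∀ g ∈ K, g ^ 5 = 1 → g = 1 := by
  have key : ∀ z, z ∈ K → T33 z → g1 * z = z * g1 := fun z hz hT' =>
    (alt_le_or hx hz hT').resolve_right hK
  have hg3 : g3 ∈ K := by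
    have : y ∈ Q9 := mem_q9 y (cube_apply hT.2) fun i =>
      congrArg (fun f : Perm (Fin 6) => f i) (key y hy hT)
    obtain ⟨k, rfl⟩ := this
    obtain ⟨p, hp⟩ := g3_mem_aux k hT.1
    rw [hp]; exact K.mul_mem (K.pow_mem hx _) (K.pow_mem hy _)
  have hsub : ∀ h ∈ Q9, h ∈ K := by
    rintro _ ⟨k, rfl⟩
    obtain ⟨p, hp⟩ := q9_form k
    rw [hp]
    exact K.mul_mem (K.pow_mem hx _) (K.pow_mem hg3 _)
  have key2 : ∀ z, z ∈ K → z ^ 3 = 1 → g1 * z = z * g1 := by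
    intro z hz hz3
    by_cases h1 : z = 1
    · simp [h1]
    rcases order_three hz3 h1 with h | h
    · have e1 := (alt_le_or' hz (K.mul_mem hx hg3) h
        ⟨by decide +kernel, by decide +kernel⟩).resolve_right hK
      have e2 := (alt_le_or' hz (K.mul_mem hx (K.inv_mem hg3)) h
        ⟨by decide +kernel, by decide +kernel⟩).resolve_right hK
      have e : g1⁻¹ = (g1 * g3) * (g1 * g3⁻¹) := by decide +kernel
      have : Commute z g1⁻¹ := by
        rw [e]; exact Commute.mul_right e1 e2
      exact (Commute.inv_right_iff.1 this).symm.eq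
    · exact key z hz h
  have key3 : ∀ z, z ∈ K → z ^ 3 = 1 → z ∈ Q9 := fun z hz h3 =>
    mem_q9 z (cube_apply h3) fun i => congrArg (fun f : Perm (Fin 6) => f i) (key2 z hz h3)
  refine ⟨Q9, ?_, fun h => ⟨fun hh => ⟨hsub h hh, by obtain ⟨k, rfl⟩ := hh; exact q9_cube k⟩, fun hh => key3 h hh.1 hh.2⟩, ?_⟩
  · exact (Nat.card_range_of_injective q9_inj).trans (by simp)
  · intro g hg h5
    refine Equiv.ext (five_aux g (fun i => ?_) ?_)
    · have := congrArg (fun f : Perm (Fin 6) => f i) h5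
      simpa [pow_succ] using this
    · have h3 : (g * g1 * g⁻¹) ^ 3 = 1 := by
        rw [conj_pow, show g1 ^ 3 = 1 by decide +kernel]; simp
      obtain ⟨k, hk⟩ := key3 _ (K.mul_mem (K.mul_mem hg hx) (K.inv_mem hg)) h3
      refine ⟨k, fun i => ?_⟩
      rw [hk]; simp

theorem lemmaA {K : Subgroup (Perm (Fin 6))} (hK : ¬ alternatingGroup (Fin 6) ≤ K)
    {x y : Perm (Fin 6)} (hx : x ∈ K) (h3 : x.IsThreeCycle) (hy : y ∈ K) (hT : T33 y) :
    ∃ Q : Subgroup (Perm (Fin 6)), Nat.card Q = 9 ∧ (∀ h, h ∈ Q ↔ h ∈ K ∧ h ^ 3 = 1) ∧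
      ∀ g ∈ K, g ^ 5 = 1 → g = 1 := by
  obtain ⟨c, hc⟩ := three_conj h3
  obtain ⟨Q, hQ, hQ', h5⟩ := lemmaA0 (K := K.map (MulAut.conj c).toMonoidHom)
    (fun h => hK (alt_le_conj h)) (y := c * y * c⁻¹)
    ⟨x, hx, by simpa using hc⟩ ⟨y, hy, by simp⟩ (hT.conj c)
  have hm : ∀ g, c * g * c⁻¹ ∈ K.map (MulAut.conj c).toMonoidHom ↔ g ∈ K := by
    intro g
    constructor
    · rintro ⟨z, hz, hz'⟩
      have : z = g := by simpa using hz'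
      exact this ▸ hz
    · intro hg; exact ⟨g, hg, by simp⟩
  refine ⟨Q.comap (MulAut.conj c).toMonoidHom, ?_, ?_, ?_⟩
  · rw [← hQ]
    exact Nat.card_congr ((MulAut.conj c).toEquiv.subtypeEquiv (fun a => Iff.rfl))
  · intro h
    have := hQ' (c * h * c⁻¹)
    rw [hm, conj_pow] at this
    rw [Subgroup.mem_comap]
    simpa using this
  · intro g hg hg5
    have := h5 _ ((hm g).2 hg) (by rw [conj_pow, hg5]; simp)
    simpa using this

theorem exists_img (g : Perm (Fin 6)) : ∀ i, ∃ j, ∀ a b, R j (g a) (g b) = R i a b := by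
  have hg : g ∈ Submonoid.closure (Set.range fun i : Fin 5 => swap i.castSucc i.succ) := by
    rw [Perm.mclosure_swap_castSucc_succ]; trivial
  induction hg using Submonoid.closure_induction with
  | mem x hx =>
    obtain ⟨k, rfl⟩ := hx
    exact R_swap k
  | one => exact fun i => ⟨i, fun a b => rfl⟩
  | mul x y _ _ hx hy =>
    intro i
    obtain ⟨j, hj⟩ := hy i
    obtain ⟨k, hk⟩ := hx j
    exact ⟨k, fun a b => (hk (y a) (y b)).trans (hj a b)⟩

/-- The image of the `i`-th bipartition under `g`. -/
noncomputable def img (g : Perm (Fin 6)) (i : Fin 11) : Fin 11 := (exists_img g i).choose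

theorem img_spec (g : Perm (Fin 6)) (i : Fin 11) (a b : Fin 6) :
    R (img g i) (g a) (g b) = R i a b := (exists_img g i).choose_spec a b

theorem img_eq {g : Perm (Fin 6)} {i j : Fin 11} (h : ∀ a b, R j (g a) (g b) = R i a b) :
    img g i = j := by
  apply R_inj
  intro a b
  have h1 := img_spec g i (g⁻¹ a) (g⁻¹ b)
  have h2 := h (g⁻¹ a) (g⁻¹ b)
  have ha : ∀ c, g (g⁻¹ c) = c := g.apply_symm_apply
  rw [ha, ha] at h1 h2
  rw [h1, h2]

/-- The action of `Perm (Fin 6)` on bipartitions. -/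
@[reducible]
noncomputable def act : MulAction (Perm (Fin 6)) (Fin 11) where
  smul := img
  one_smul _ := img_eq fun _ _ => rfl
  mul_smul g h i := img_eq fun a b =>
    (img_spec g (img h i) (h a) (h b)).trans (img_spec h i a b)

/-- The permutation representation on bipartitions. -/
noncomputable def psi : Perm (Fin 6) →* Perm (Fin 11) :=
  @MulAction.toPermHom _ _ _ act

theorem psi_apply (g : Perm (Fin 6)) (i : Fin 11) : psi g i = img g i := rfl

theorem psi_eq {g : Perm (Fin 6)} {h : Perm (Fin 11)}
    (H : ∀ i a b, R (h i) (g a) (g b) = R i a b) : psi g = h :=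
  Equiv.ext fun i => img_eq (H i)

theorem psi_inj : Function.Injective psi := by
  rw [injective_iff_map_eq_one]
  intro g hg
  refine Equiv.ext (psi_inj_aux g fun i a b => ?_)
  have h := img_spec g i a b
  rwa [← psi_apply, hg] at h

theorem psi_ten (g : Perm (Fin 6)) : psi g 10 = 10 := by
  rw [psi_apply]
  apply img_eq
  have : ∀ a b, R 10 a b = true := by decide
  intro a b
  rw [this, this]

theorem psi_g1 : psi g1 = m11b * m11a⁻¹ * m11b := psi_eq (by decide +kernel)
theorem psi_g2 : psi g2 = m11b * m11b * m11a * m11a * m11a := psi_eq (by decide +kernel)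
theorem t_eq : t = m11a⁻¹ * m11b * m11a := by decide +kernel
theorem psi_k1 : psi k1 = t * psi g1 * t⁻¹ := by rw [psi_g1]; exact psi_eq (by decide +kernel)
theorem psi_k2 : psi k2 = t * psi g2 * t⁻¹ := by rw [psi_g2]; exact psi_eq (by decide +kernel)
theorem psi_tt : psi tt = t * t := psi_eq (by decide +kernel)

/-- The copy of the alternating group. -/
noncomputable def NN : Subgroup (Perm (Fin 11)) := (alternatingGroup (Fin 6)).map psi

theorem psi_mem_NN {g : Perm (Fin 6)} : psi g ∈ NN ↔ g ∈ alternatingGroup (Fin 6) :=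
  Subgroup.mem_map_iff_mem psi_inj

theorem alt_eq : alternatingGroup (Fin 6) = Subgroup.closure {g1, g2} := by
  apply le_antisymm
  · exact alt_le (Subgroup.subset_closure (by simp)) (Subgroup.subset_closure (by simp))
  · rw [Subgroup.closure_le]
    rintro x (rfl | rfl)
    · exact g1_three.mem_alternatingGroup
    · have : Perm.sign g2 = 1 := by decide +kernel
      exact this

theorem t_conj {n : Perm (Fin 11)} (hn : n ∈ NN) : t * n * t⁻¹ ∈ NN := by
  obtain ⟨g, hg, rfl⟩ := hn
  have hg' : g ∈ Subgroup.closure {g1, g2} := alt_eq ▸ hg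
  suffices h : Subgroup.closure {g1, g2} ≤
      NN.comap ((MulAut.conj t).toMonoidHom.comp psi) by
    exact h hg'
  rw [Subgroup.closure_le]
  rintro x (rfl | rfl)
  · change t * psi g1 * t⁻¹ ∈ NN
    rw [← psi_k1, psi_mem_NN, Perm.mem_alternatingGroup]; decide +kernel
  · change t * psi g2 * t⁻¹ ∈ NN
    rw [← psi_k2, psi_mem_NN, Perm.mem_alternatingGroup]; decide +kernel

theorem tt_mem : t * t ∈ NN := by
  rw [← psi_tt, psi_mem_NN, Perm.mem_alternatingGroup]; decide +kernel

theorem g1_mem : g1 ∈ alternatingGroup (Fin 6) := g1_three.mem_alternatingGroup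

theorem not_T33_three {x : Perm (Fin 6)} (h : x.IsThreeCycle) (h' : T33 x) : False := by
  have h1 := h'.cycleType
  rw [h.cycleType] at h1
  have := congrArg Multiset.card h1
  simp at this

theorem t_not_mem : t ∉ NN := by
  rintro ⟨g, -, hg⟩
  have h := psi_k1
  rw [← hg, ← map_mul, ← map_inv, ← map_mul] at h
  have h2 := psi_inj h
  refine not_T33_three (x := k1) ?_ k1_T33
  rw [h2, Perm.IsThreeCycle, Perm.cycleType_conj]
  exact g1_three

/-- The group generated by `NN` and `t`. -/
noncomputable def HH : Subgroup (Perm (Fin 11)) where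
  carrier := {h | h ∈ NN ∨ ∃ n ∈ NN, h = n * t}
  one_mem' := Or.inl NN.one_mem
  mul_mem' := by
    rintro x y (hx | ⟨n, hn, rfl⟩) (hy | ⟨m, hm, rfl⟩)
    · exact Or.inl (NN.mul_mem hx hy)
    · exact Or.inr ⟨x * m, NN.mul_mem hx hm, by group⟩
    · exact Or.inr ⟨n * (t * y * t⁻¹), NN.mul_mem hn (t_conj hy), by group⟩
    · refine Or.inl ?_
      have := NN.mul_mem (NN.mul_mem hn (t_conj hm)) tt_mem
      convert this using 1
      group
  inv_mem' := by
    rintro x (hx | ⟨n, hn, rfl⟩)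
    · exact Or.inl (NN.inv_mem hx)
    · refine Or.inr ⟨(t * t)⁻¹ * (t * n⁻¹ * t⁻¹),
        NN.mul_mem (NN.inv_mem tt_mem) (t_conj (NN.inv_mem hn)), by group⟩

theorem mem_HH {h : Perm (Fin 11)} : h ∈ HH ↔ h ∈ NN ∨ ∃ n ∈ NN, h = n * t := Iff.rfl

theorem NN_le_HH : NN ≤ HH := fun _ h => Or.inl h

theorem t_mem_HH : t ∈ HH := Or.inr ⟨1, NN.one_mem, by simp⟩

theorem HH_ten {h : Perm (Fin 11)} (hh : h ∈ HH) : h 10 = 10 := by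
  rcases hh with ⟨g, -, rfl⟩ | ⟨n, ⟨g, -, rfl⟩, rfl⟩
  · exact psi_ten g
  · rw [Perm.mul_apply, show t 10 = 10 by decide, psi_ten]

theorem HH_le_M11 : HH ≤ M11 := by
  have ha : m11a ∈ M11 := Subgroup.subset_closure (by simp)
  have hb : m11b ∈ M11 := Subgroup.subset_closure (by simp)
  have ht : t ∈ M11 := by
    rw [t_eq]; exact M11.mul_mem (M11.mul_mem (M11.inv_mem ha) hb) ha
  have hN : NN ≤ M11 := by
    rw [NN, alt_eq, Subgroup.map_le_iff_le_comap, Subgroup.closure_le]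
    rintro x (rfl | rfl)
    · change psi g1 ∈ M11
      rw [psi_g1]
      exact M11.mul_mem (M11.mul_mem hb (M11.inv_mem ha)) hb
    · change psi g2 ∈ M11
      rw [psi_g2]
      exact M11.mul_mem (M11.mul_mem (M11.mul_mem (M11.mul_mem hb hb) ha) ha) ha
  rintro x (hx | ⟨n, hn, rfl⟩)
  · exact hN hx
  · exact M11.mul_mem (hN hn) ht

theorem a_pow : m11a ^ 11 = 1 := by decide +kernel

theorem a_pow_mod (n : ℕ) : m11a ^ n = m11a ^ (n % 11) := by
  conv_lhs => rw [← Nat.div_add_mod n 11, pow_add, pow_mul, a_pow, one_pow, one_mul]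

theorem b_step (n : ℕ) : ∃ m : ℕ, ∃ h ∈ HH, m11b * m11a ^ n = m11a ^ m * h := by
  rw [a_pow_mod]
  set i : Fin 11 := ⟨n % 11, Nat.mod_lt _ (by norm_num)⟩ with hi
  have h := psi_eq (step_b i)
  have hm : psi (gv i) ∈ HH := NN_le_HH (psi_mem_NN.2 (sign_gv i))
  refine ⟨jv i, (m11a ^ jv i)⁻¹ * m11b * m11a ^ (i : ℕ), ?_, by rw [hi]; group⟩
  rw [h] at hm
  refine (Subgroup.mul_mem_cancel_right _ ?_).1 hm
  split_ifs
  · exact HH.inv_mem t_mem_HH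
  · exact HH.one_mem

theorem M11_form {g : Perm (Fin 11)} (hg : g ∈ M11) : ∃ n : ℕ, ∃ h ∈ HH, g = m11a ^ n * h := by
  have hA : ∀ y, (∃ n : ℕ, ∃ h ∈ HH, y = m11a ^ n * h) →
      ∃ n : ℕ, ∃ h ∈ HH, m11a * y = m11a ^ n * h := by
    rintro _ ⟨n, h, hh, rfl⟩
    exact ⟨n + 1, h, hh, by rw [pow_succ', mul_assoc]⟩
  have hB : ∀ y, (∃ n : ℕ, ∃ h ∈ HH, y = m11a ^ n * h) →
      ∃ n : ℕ, ∃ h ∈ HH, m11b * y = m11a ^ n * h := by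
    rintro _ ⟨n, h, hh, rfl⟩
    obtain ⟨m, k, hk, e⟩ := b_step n
    exact ⟨m, k * h, HH.mul_mem hk hh, by rw [← mul_assoc, e, mul_assoc]⟩
  induction hg using Subgroup.closure_induction_left with
  | one => exact ⟨0, 1, HH.one_mem, by simp⟩
  | mul_left x hx y _ ih =>
    rcases hx with rfl | rfl
    · exact hA _ ih
    · exact hB _ ih
  | inv_mul_cancel x hx y _ ih =>
    rcases hx with rfl | rfl
    · obtain ⟨n, h, hh, rfl⟩ := ih
      refine ⟨n + 10, h, hh, ?_⟩
      rw [inv_mul_eq_iff_eq_mul, ← mul_assoc, ← pow_succ', show n + 10 + 1 = n + 11 by rfl,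
        pow_add, a_pow, mul_one]
    · have e : m11b⁻¹ = m11b * (m11b * m11b) := by decide +kernel
      rw [e, mul_assoc, mul_assoc]
      exact hB _ (hB _ (hB _ ih))

theorem M10_eq : M10 = HH := by
  apply le_antisymm
  · rintro g ⟨hg, hs⟩
    obtain ⟨n, h, hh, rfl⟩ := M11_form hg
    have h1 : (m11a ^ n * h) 10 = 10 := hs
    rw [Perm.mul_apply, HH_ten hh, a_pow_mod] at h1
    have key : ∀ i : Fin 11, (m11a ^ (i : ℕ)) 10 = 10 → i = 0 := by decide +kernel
    have h2 := key ⟨n % 11, Nat.mod_lt _ (by norm_num)⟩ h1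
    have h3 : n % 11 = 0 := congrArg Fin.val h2
    rw [a_pow_mod, h3, pow_zero, one_mul]
    exact hh
  · intro h hh
    exact ⟨HH_le_M11 hh, HH_ten hh⟩

theorem mul_mem_of_not_mem {x y : Perm (Fin 11)} (hx : x ∈ HH) (hy : y ∈ HH) (hx' : x ∉ NN)
    (hy' : y ∉ NN) : x * y ∈ NN := by
  obtain ⟨n, hn, rfl⟩ := hx.resolve_left hx'
  obtain ⟨m, hm, rfl⟩ := hy.resolve_left hy'
  have := NN.mul_mem (NN.mul_mem hn (t_conj hm)) tt_mem
  convert this using 1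
  group

theorem HH_conj {s n : Perm (Fin 11)} (hs : s ∈ HH) (hn : n ∈ NN) : s * n * s⁻¹ ∈ NN := by
  rcases hs with hs | ⟨m, hm, rfl⟩
  · exact NN.mul_mem (NN.mul_mem hs hn) (NN.inv_mem hs)
  · have := NN.mul_mem (NN.mul_mem hm (t_conj hn)) (NN.inv_mem hm)
    convert this using 1
    group

/-- Generic transfer: conjugation by an outer element, from one class representative. -/
theorem outer_conj {s : Perm (Fin 11)} (hs : s ∈ HH) (hs' : s ∉ NN) {x x0 y0 : Perm (Fin 6)}
    (h0 : ∃ c ∈ alternatingGroup (Fin 6), c * x * c⁻¹ = x0)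
    (ht : psi y0 = t * psi x0 * t⁻¹) : ∃ d, s * psi x * s⁻¹ = psi (d * y0 * d⁻¹) := by
  obtain ⟨_, ⟨m, -, rfl⟩, rfl⟩ := hs.resolve_left hs'
  obtain ⟨c, hc, rfl⟩ := h0
  obtain ⟨d, -, hd⟩ := t_conj (psi_mem_NN.2 (inv_mem hc))
  refine ⟨m * d, ?_⟩
  rw [map_mul, map_mul, ht, map_inv, map_mul, hd]
  simp only [map_mul, map_inv]
  group

theorem outer_three {s : Perm (Fin 11)} (hs : s ∈ HH) (hs' : s ∉ NN) {x : Perm (Fin 6)}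
    (h : x.IsThreeCycle) : ∃ y, T33 y ∧ s * psi x * s⁻¹ = psi y := by
  obtain ⟨d, hd⟩ := outer_conj hs hs' (three_conj' h) psi_k1
  exact ⟨_, k1_T33.conj d, hd⟩

theorem outer_T33 {s : Perm (Fin 11)} (hs : s ∈ HH) (hs' : s ∉ NN) {x : Perm (Fin 6)}
    (h : T33 x) : ∃ y, y.IsThreeCycle ∧ s * psi x * s⁻¹ = psi y := by
  have e : psi (tt * g1 * tt⁻¹) = t * psi k1 * t⁻¹ := by
    rw [psi_k1, map_mul, map_mul, map_inv, psi_tt]; group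
  obtain ⟨d, hd⟩ := outer_conj hs hs' (T33_conj' h) e
  refine ⟨_, ?_, hd⟩
  rw [Perm.IsThreeCycle, Perm.cycleType_conj, Perm.cycleType_conj]
  exact g1_three

theorem pnil {G : Type*} [Group G] [Finite G] (P : Subgroup G) (hP : P.Normal)
    (hodd : Nat.Coprime (Nat.card P) 2) (hidx : ∃ k, Nat.card G = Nat.card P * k ∧ k ∣ 16) :
    IsPNilpotent 2 G := by
  have : Fact (Nat.Prime 2) := ⟨Nat.prime_two⟩
  obtain ⟨k, hk, hk16⟩ := hidx
  obtain ⟨n, -, rfl⟩ := (Nat.dvd_prime_pow Nat.prime_two (m := 4)).1 (by simpa using hk16)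
  refine ⟨P, hP, fun S => ?_⟩
  have hc : Nat.card S = 2 ^ n := by
    rw [S.card_eq_multiplicity, hk, Nat.factorization_mul Nat.card_pos.ne' (by positivity)]
    have : (Nat.card P).factorization 2 = 0 :=
      Nat.factorization_eq_zero_of_not_dvd fun h => by
        have := Nat.dvd_gcd h (dvd_refl 2)
        rw [hodd] at this
        omega
    simp [this, Nat.Prime.factorization_pow Nat.prime_two]
  apply Subgroup.isComplement'_of_coprime
  · change Nat.card P * Nat.card S = _
    rw [hc, hk]
  · change Nat.Coprime (Nat.card P) (Nat.card S)
    rw [hc]; exact hodd.pow_right n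

theorem NN_le : NN ≤ M10 := M10_eq ▸ NN_le_HH

theorem val_mem (x : M10) : (x : Perm (Fin 11)) ∈ HH := M10_eq ▸ x.2

/-- The normal subgroup of index two, inside `M10`. -/
noncomputable def N : Subgroup M10 := NN.subgroupOf M10

theorem mem_N {x : M10} : x ∈ N ↔ (x : Perm (Fin 11)) ∈ NN := Iff.rfl

theorem N_normal : N.Normal := ⟨fun _ hn s => HH_conj (val_mem s) hn⟩

/-- The isomorphism with the alternating group. -/
noncomputable def isoN : N ≃* alternatingGroup (Fin 6) :=
  (Subgroup.subgroupOfEquivOfLe NN_le).trans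
    ((alternatingGroup (Fin 6)).equivMapOfInjective psi psi_inj).symm

theorem N_card : Nat.card N = 360 := by
  rw [Nat.card_congr isoN.toEquiv, nat_card_alternatingGroup]
  simp [Nat.factorial]

theorem N_index : N.index = 2 := by
  have hT : t ∈ M10 := M10_eq ▸ t_mem_HH
  rw [Subgroup.index_eq_two_iff]
  refine ⟨⟨t, hT⟩, fun b => ?_⟩
  by_cases hb : b ∈ N
  · right
    refine ⟨hb, fun h => t_not_mem ?_⟩
    exact (NN.mul_mem_cancel_left hb).1 h
  · left
    exact ⟨mul_mem_of_not_mem (val_mem b) t_mem_HH hb t_not_mem, hb⟩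

theorem M10_card : Nat.card M10 = 720 := by
  rw [← N.card_mul_index, N_card, N_index]

theorem N_coatom : IsCoatom N := by
  refine ⟨fun h => ?_, fun K hK => ?_⟩
  · have := N_index
    rw [h, Subgroup.index_top] at this
    omega
  · obtain ⟨hle, s, hs, hs'⟩ := SetLike.lt_iff_le_and_exists.1 hK
    rw [eq_top_iff]
    intro x _
    by_cases hx : x ∈ N
    · exact hle hx
    · have h : x * s ∈ N := by
        rw [Subgroup.mul_mem_iff_of_index_two N_index]
        simp [hx, hs']
      exact (K.mul_mem_cancel_right hs).1 (hle h)

theorem N_min (K : Subgroup M10) (hK : K.Normal) (hb : K ≠ ⊥) (hle : K ≤ N) : K = N := by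
  have hsimp : IsSimpleGroup (alternatingGroup (Fin 6)) :=
    alternatingGroup.isSimpleGroup (by simp)
  have : Nontrivial N := isoN.toEquiv.nontrivial
  have hS : IsSimpleGroup N := isoN.isSimpleGroup
  have hn : (K.subgroupOf N).Normal := hK.subgroupOf N
  rcases hn.eq_bot_or_eq_top with h | h
  · exfalso
    rw [Subgroup.subgroupOf_eq_bot, disjoint_iff, inf_eq_left.2 hle] at h
    exact hb h
  · exact le_antisymm hle (Subgroup.subgroupOf_eq_top.1 h)

theorem odd_mem {z : Perm (Fin 11)} (hz : z ∈ HH) (h : z ^ 3 = 1 ∨ z ^ 5 = 1) : z ∈ NN := by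
  by_contra hn
  have h2 : z * z ∈ NN := mul_mem_of_not_mem hz hz hn hn
  apply hn
  rcases h with h | h
  · have : z = (z * z)⁻¹ := by
      rw [eq_inv_iff_mul_eq_one, ← h]; simp only [pow_succ, pow_zero, one_mul, mul_assoc]
    rw [this]; exact NN.inv_mem h2
  · have : z = ((z * z) * (z * z))⁻¹ := by
      rw [eq_inv_iff_mul_eq_one, ← h]; simp only [pow_succ, pow_zero, one_mul, mul_assoc]
    rw [this]; exact NN.inv_mem (NN.mul_mem h2 h2)

theorem main_nil (M : Subgroup M10) (hM : IsCoatom M) (hMN : M ≠ N) : IsPNilpotent 2 M := by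
  have hnle : ¬ N ≤ M := fun h => by
    rcases N_coatom.le_iff.1 h with h' | h'
    · exact hM.1 h'
    · exact hMN h'
  have hnle' : ¬ M ≤ N := fun h => by
    rcases hM.le_iff.1 h with h' | h'
    · exact N_coatom.1 h'
    · exact hMN h'.symm
  obtain ⟨s, hsM, hsN⟩ := SetLike.not_le_iff_exists.1 hnle'
  have hcard : Nat.card M ∣ 720 := M10_card ▸ M.card_subgroup_dvd_card
  let j : M →* Perm (Fin 11) := M10.subtype.comp M.subtype
  have hj : Function.Injective j := Subtype.val_injective.comp Subtype.val_injective
  have hjH : ∀ m, j m ∈ HH := fun m => val_mem m.1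
  have hNN : ∀ m, (j m) ^ 3 = 1 ∨ (j m) ^ 5 = 1 → ∃ x ∈ alternatingGroup (Fin 6), psi x = j m :=
    fun m h => odd_mem (hjH m) h
  let K : Subgroup (Perm (Fin 6)) := j.range.comap psi ⊓ alternatingGroup (Fin 6)
  have hK : ¬ alternatingGroup (Fin 6) ≤ K := by
    intro h
    apply hnle
    rintro ⟨x, hx⟩ hxN
    obtain ⟨g, hg, rfl⟩ := mem_N.1 hxN
    obtain ⟨m, hm⟩ := (h hg).1
    have : (m : M10) = ⟨psi g, hx⟩ := Subtype.ext hm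
    exact this ▸ m.2
  have hconj : ∀ x ∈ K, ∀ y, (s : Perm (Fin 11)) * psi x * (s : Perm (Fin 11))⁻¹ = psi y →
      y ∈ K := by
    rintro x ⟨⟨m, hm⟩, hxA⟩ y hy
    refine ⟨⟨⟨s, hsM⟩ * m * ⟨s, hsM⟩⁻¹, ?_⟩, ?_⟩
    · rw [← hy, ← hm]; simp [j]
    · change y ∈ alternatingGroup (Fin 6)
      rw [← psi_mem_NN, ← hy]
      exact HH_conj (val_mem s) (psi_mem_NN.2 hxA)
  by_cases h3 : 3 ∣ Nat.card M
  · have : Fact (Nat.Prime 3) := ⟨by norm_num⟩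
    obtain ⟨m, hm⟩ := exists_prime_orderOf_dvd_card' 3 h3
    have hm3 : m ^ 3 = 1 := hm ▸ pow_orderOf_eq_one m
    have hm1 : m ≠ 1 := by rintro rfl; simp at hm
    obtain ⟨x, hxA, hx⟩ := hNN m (Or.inl (by rw [← map_pow, hm3, map_one]))
    have hx3 : x ^ 3 = 1 := psi_inj (by rw [map_pow, hx, ← map_pow, hm3, map_one, map_one])
    have hx1 : x ≠ 1 := by
      rintro rfl
      exact hm1 (hj (by rw [← hx, map_one, map_one]))
    have hxK : x ∈ K := ⟨⟨m, hx.symm⟩, hxA⟩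
    obtain ⟨u, v, huK, hu, hvK, hv⟩ : ∃ u v, u ∈ K ∧ u.IsThreeCycle ∧ v ∈ K ∧ T33 v := by
      rcases order_three hx3 hx1 with h | h
      · obtain ⟨y, hy, hy'⟩ := outer_three (val_mem s) hsN h
        exact ⟨x, y, hxK, h, hconj x hxK y hy', hy⟩
      · obtain ⟨y, hy, hy'⟩ := outer_T33 (val_mem s) hsN h
        exact ⟨y, x, hconj x hxK y hy', hy, hxK, h⟩
    obtain ⟨Q, hQ9, hQ, hQ5⟩ := lemmaA hK huK hu hvK hv
    have h5 : ¬ 5 ∣ Nat.card M := by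
      intro h5
      have : Fact (Nat.Prime 5) := ⟨by norm_num⟩
      obtain ⟨z, hz⟩ := exists_prime_orderOf_dvd_card' 5 h5
      have hz5 : z ^ 5 = 1 := hz ▸ pow_orderOf_eq_one z
      obtain ⟨g, hgA, hg⟩ := hNN z (Or.inr (by rw [← map_pow, hz5, map_one]))
      have hg5 : g ^ 5 = 1 := psi_inj (by rw [map_pow, hg, ← map_pow, hz5, map_one, map_one])
      have hg1 := hQ5 g ⟨⟨z, hg.symm⟩, hgA⟩ hg5
      have : z = 1 := hj (by rw [← hg, hg1, map_one, map_one])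
      rw [this] at hz
      simp at hz
    let P : Subgroup M := (Q.map psi).comap j
    have hPm : ∀ z, z ∈ P ↔ z ^ 3 = 1 := by
      intro z
      constructor
      · rintro ⟨q, hq, hq'⟩
        apply hj
        rw [map_pow, ← hq', ← map_pow, ((hQ q).1 hq).2, map_one, map_one]
      · intro hz
        obtain ⟨g, hgA, hg⟩ := hNN z (Or.inl (by rw [← map_pow, hz, map_one]))
        have hg3 : g ^ 3 = 1 := psi_inj (by rw [map_pow, hg, ← map_pow, hz, map_one, map_one])
        exact ⟨g, (hQ g).2 ⟨⟨⟨z, hg.symm⟩, hgA⟩, hg3⟩, hg⟩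
    have hPc : Nat.card P = 9 := by
      have hle : Q.map psi ≤ j.range := by
        rintro _ ⟨q, hq, rfl⟩
        exact ((hQ q).1 hq).1.1
      have h1 : P.map j = Q.map psi := Subgroup.map_comap_eq_self hle
      rw [← Subgroup.card_map_of_injective hj, h1, Subgroup.card_map_of_injective psi_inj, hQ9]
    refine pnil P ⟨fun n hn g => ?_⟩ (by rw [hPc]; decide) ?_
    · rw [hPm] at hn ⊢
      rw [conj_pow, hn]; simp
    · obtain ⟨k, hk⟩ := P.card_subgroup_dvd_card
      refine ⟨k, hk, ?_⟩
      rw [hk, hPc] at hcard h5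
      have h80 : k ∣ 16 * 5 := Nat.dvd_of_mul_dvd_mul_left (by norm_num : 0 < 9) (by simpa using hcard)
      refine Nat.Coprime.dvd_of_dvd_mul_right ?_ h80
      rw [Nat.coprime_comm, Nat.Prime.coprime_iff_not_dvd (by norm_num)]
      exact fun h => h5 (h.mul_left 9)
  · have h80 : Nat.card M ∣ 80 := by
      have : Nat.card M ∣ 80 * 9 := by simpa using hcard
      refine Nat.Coprime.dvd_of_dvd_mul_right ?_ this
      rw [show 9 = 3 ^ 2 by rfl]
      exact Nat.Coprime.pow_right 2
        (((Nat.Prime.coprime_iff_not_dvd (by norm_num)).2 h3).symm)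
    by_cases h5 : 5 ∣ Nat.card M
    · have : Fact (Nat.Prime 5) := ⟨by norm_num⟩
      have := N_normal
      let M0 : Subgroup M := N.subgroupOf M
      have hM0n : M0.Normal := N_normal.subgroupOf M
      have hidx : M0.index ∣ 2 := by
        have := Subgroup.relIndex_dvd_index_of_normal N M
        rwa [N_index] at this
      have hM0c : Nat.card M0 ∣ 40 := by
        have h1 : M0.index = 2 := by
          rcases (Nat.dvd_prime Nat.prime_two).1 hidx with h | h
          · exact absurd (Subgroup.relIndex_eq_one.1 h) hnle'
          · exact h
        have h2 := M0.card_mul_index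
        rw [h1] at h2
        rw [← h2] at h80
        exact Nat.dvd_of_mul_dvd_mul_right (by norm_num : 0 < 2) (by simpa using h80)
      have h50 : 5 ∣ Nat.card M0 := by
        have h2 := M0.card_mul_index
        rw [← h2] at h5
        refine Nat.Coprime.dvd_of_dvd_mul_right ?_ h5
        exact Nat.Coprime.coprime_dvd_right hidx (by norm_num)
      let S : Sylow 5 M0 := default
      have hn1 : Nat.card (Sylow 5 M0) = 1 := by
        have h1 := card_sylow_modEq_one 5 M0
        have h2 : Nat.card (Sylow 5 M0) ∣ 40 :=
          (S.card_dvd_index.trans (Subgroup.index_dvd_card _)).trans hM0c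
        have h3 : Nat.card (Sylow 5 M0) ∈ Nat.divisors 40 := by simp [h2]
        have h4 : ∀ n ∈ Nat.divisors 40, n % 5 = 1 % 5 → n = 1 := by decide +kernel
        exact h4 _ h3 h1
      have : Subsingleton (Sylow 5 M0) := (Nat.card_eq_one_iff_unique.1 hn1).1
      have hchar : (S : Subgroup M0).Characteristic := S.characteristic_of_subsingleton
      have hSc : Nat.card S = 5 := by
        apply Nat.dvd_antisymm
        · have h1 : Nat.card S ∣ 5 * 8 := S.1.card_subgroup_dvd_card.trans hM0c
          refine Nat.Coprime.dvd_of_dvd_mul_right ?_ h1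
          rw [S.card_eq_multiplicity]
          exact Nat.Coprime.pow_left _ (by norm_num)
        · exact S.dvd_card_of_dvd_card h50
      have hPc : Nat.card ((S : Subgroup M0).map M0.subtype) = 5 := by
        rw [Subgroup.card_map_of_injective M0.subtype_injective]; exact hSc
      refine pnil ((S : Subgroup M0).map M0.subtype) inferInstance (by rw [hPc]; decide) ?_
      obtain ⟨k, hk⟩ := ((S : Subgroup M0).map M0.subtype).card_subgroup_dvd_card
      refine ⟨k, hk, ?_⟩
      rw [hk, hPc] at h80
      exact Nat.dvd_of_mul_dvd_mul_left (by norm_num : 0 < 5) (by simpa using h80)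
    · refine pnil ⊥ inferInstance (by simp) ⟨Nat.card M, by simp, ?_⟩
      refine Nat.Coprime.dvd_of_dvd_mul_right (m := 16) (n := 5) ?_ (by simpa using h80)
      exact ((Nat.Prime.coprime_iff_not_dvd (by norm_num)).2 h5).symm

end M10aux

theorem stmt_12 :
    ∃ N : Subgroup M10, N.Normal ∧ N ≠ ⊥ ∧
      (∀ K : Subgroup M10, K.Normal → K ≠ ⊥ → K ≤ N → K = N) ∧
      Nonempty (N ≃* alternatingGroup (Fin 6)) ∧ N.index = 2 ∧ IsCoatom N ∧
      ∀ M : Subgroup M10, IsCoatom M → M ≠ N → IsPNilpotent 2 M := by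
  exact ⟨M10aux.N, M10aux.N_normal, fun h => by
      have h1 := M10aux.N_card
      rw [h] at h1
      simp at h1, M10aux.N_min, ⟨M10aux.isoN⟩, M10aux.N_index, M10aux.N_coatom,
    M10aux.main_nil⟩
end

section
/- In both PSL_2(8) and PΓL_2(8) = PSL_2(8).3, a Sylow 3-subgroup is not a maximal subgroup and is not contained in any subgroup of prime index or squared-prime index. -/
open Matrix

/-- `PSL₂(8)`. -/
abbrev PSL2_8 : Type := ProjectiveSpecialLinearGroup (Fin 2) (GaloisField 2 3)

/-- `PΓL₂(8)`, realized as the full automorphism group of the simple group `PSL₂(8)`. -/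
abbrev PGammaL2_8 : Type := MulAut PSL2_8


/-- Concrete model of the field with eight elements, `𝔽₂[x]/(x³+x+1)`, bit-coded. -/
def K8 : Type := Fin 8

namespace K8

instance : DecidableEq K8 := inferInstanceAs (DecidableEq (Fin 8))
instance : Fintype K8 := inferInstanceAs (Fintype (Fin 8))

/-- Bit-packed multiplication table. -/
def table : ℕ := 2821848294356612419217921029917578219971947684264937521152

def mk (n : ℕ) : K8 := (⟨n % 8, Nat.mod_lt _ (by decide)⟩ : Fin 8)
def add (x y : K8) : K8 := mk (Nat.xor x.1 y.1)
def mul (x y : K8) : K8 := mk (Nat.shiftRight table (3 * (8 * x.1 + y.1)))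

instance : Zero K8 := ⟨mk 0⟩
instance : One K8 := ⟨mk 1⟩
instance : Add K8 := ⟨add⟩
instance : Mul K8 := ⟨mul⟩
instance : Neg K8 := ⟨fun x => x⟩

instance instCR : CommRing K8 where
  add_assoc := by decide +kernel
  zero_add := by decide +kernel
  add_zero := by decide +kernel
  add_comm := by decide +kernel
  nsmul := nsmulRec
  zsmul := zsmulRec
  neg_add_cancel := by decide +kernel
  mul_assoc := by decide +kernel
  one_mul := by decide +kernel
  mul_one := by decide +kernel
  mul_comm := by decide +kernel
  left_distrib := by decide +kernel
  right_distrib := by decide +kernel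
  zero_mul := by decide +kernel
  mul_zero := by decide +kernel

instance : Field K8 where
  toCommRing := instCR
  inv x := mul (mul (mul x x) (mul x x)) (mul x x)
  exists_pair_ne := ⟨mk 0, mk 1, by decide +kernel⟩
  mul_inv_cancel := by decide +kernel
  inv_zero := by decide +kernel
  nnqsmul := _
  nnqsmul_def := fun _ _ => rfl
  qsmul := _
  qsmul_def := fun _ _ => rfl

theorem two : (1 : K8) + 1 = 0 := by decide +kernel
theorem add_self (x : K8) : x + x = 0 := by revert x; decide +kernel
theorem neg_eq (x : K8) : -x = x := rfl

noncomputable def iso : K8 ≃+* GaloisField 2 3 := by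
  haveI : Fintype (GaloisField 2 3) := Fintype.ofFinite _
  refine FiniteField.ringEquivOfCardEq ?_
  rw [← Nat.card_eq_fintype_card (α := GaloisField 2 3), GaloisField.card 2 3 (by decide)]
  rfl

end K8

/-- Concrete model of `SL₂(8)`. -/
@[ext] structure S8 : Type where
  a : K8
  b : K8
  c : K8
  d : K8
  h : a * d + b * c = 1

namespace S8

instance : DecidableEq S8 := fun x y =>
  decidable_of_iff (x.a = y.a ∧ x.b = y.b ∧ x.c = y.c ∧ x.d = y.d) (by rw [S8.ext_iff])

instance : One S8 := ⟨⟨1, 0, 0, 1, by decide +kernel⟩⟩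

instance : Mul S8 := ⟨fun x y => ⟨x.a * y.a + x.b * y.c, x.a * y.b + x.b * y.d,
  x.c * y.a + x.d * y.c, x.c * y.b + x.d * y.d, by
    have e : (x.a * x.d + x.b * x.c) * (y.a * y.d + y.b * y.c) = 1 := by rw [x.h, y.h, one_mul]
    have t := K8.two
    linear_combination e + (x.a * y.a * x.c * y.b + x.b * y.c * x.d * y.d) * t⟩⟩

instance : Inv S8 := ⟨fun x => ⟨x.d, x.b, x.c, x.a, by
  rw [mul_comm x.d]; exact x.h⟩⟩

theorem mul_def (x y : S8) : x * y = ⟨x.a * y.a + x.b * y.c, x.a * y.b + x.b * y.d,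
  x.c * y.a + x.d * y.c, x.c * y.b + x.d * y.d, (x * y).h⟩ := rfl

instance : Group S8 where
  mul_assoc x y z := by
    ext <;> simp only [mul_def] <;> ring
  one_mul x := by
    ext <;> change (_ : K8) * _ + _ * _ = _ <;> first | exact (by intros; ring : ∀ u v : K8, 1 * u + 0 * v = u) _ _ | exact (by intros; ring : ∀ u v : K8, 0 * u + 1 * v = v) _ _ 
  mul_one x := by
    ext <;> change (_ : K8) * _ + _ * _ = _ <;> first | exact (by intros; ring : ∀ u v : K8, u * 1 + v * 0 = u) _ _ | exact (by intros; ring : ∀ u v : K8, u * 0 + v * 1 = v) _ _ 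
  inv_mul_cancel x := by
    have t := K8.two
    have h := x.h
    ext
    · change x.d * x.a + x.b * x.c = 1
      linear_combination h
    · change x.d * x.b + x.b * x.d = 0
      linear_combination (x.b * x.d) * t
    · change x.c * x.a + x.a * x.c = 0
      linear_combination (x.a * x.c) * t
    · change x.c * x.b + x.a * x.d = 1
      linear_combination h

/-- Checking a predicate on the concrete group amounts to checking all quadruples. -/
theorem all_iff (P : S8 → Prop) : (∀ x, P x) ↔ ∀ a b c d, ∀ h : a * d + b * c = 1, P ⟨a, b, c, d, h⟩ :=
  ⟨fun H _ _ _ _ _ => H _, fun H x => H x.a x.b x.c x.d x.h⟩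

def toQuad (x : S8) : K8 × K8 × K8 × K8 := (x.a, x.b, x.c, x.d)
theorem toQuad_inj : Function.Injective toQuad := by
  intro x y h
  simp only [toQuad, Prod.mk.injEq] at h
  exact S8.ext h.1 h.2.1 h.2.2.1 h.2.2.2
instance : Finite S8 := Finite.of_injective _ toQuad_inj

def quadEquiv : S8 ≃ {q : K8 × K8 × K8 × K8 // q.1 * q.2.2.2 + q.2.1 * q.2.2.1 = 1} where
  toFun x := ⟨toQuad x, x.h⟩
  invFun q := ⟨q.1.1, q.1.2.1, q.1.2.2.1, q.1.2.2.2, q.2⟩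
  left_inv _ := rfl
  right_inv _ := rfl

theorem card : Nat.card S8 = 504 := by
  rw [Nat.card_congr quadEquiv, Nat.card_eq_fintype_card]
  decide +kernel

theorem inv_iff (x : S8) : (x ^ 2 = 1 ∧ x ≠ 1) ↔ x.a = x.d ∧ ¬ (x.b = 0 ∧ x.c = 0) := by
  revert x
  rw [all_iff]
  decide +kernel

theorem three_iff (x : S8) : (x ^ 3 = 1 ∧ x ≠ 1) ↔ x.d = x.a + 1 := by
  revert x
  rw [all_iff]
  decide +kernel

def T7 (t : K8) : Bool := t * t * t + t * t + 1 = 0 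

theorem seven_iff (x : S8) : (x ^ 7 = 1 ∧ x ≠ 1) ↔ T7 (x.a + x.d) := by
  revert x
  rw [all_iff]
  decide +kernel


def b0 : S8 := ⟨0, 1, 1, 1, by decide +kernel⟩

theorem conj_three_aux : ∀ a b c d : K8, ∀ h : a * d + b * c = 1, d = a + 1 →
    ∃ x y : K8, ∃ h' : x * (c * x + d * y) + (a * x + b * y) * y = 1,
      (⟨x, a * x + b * y, y, c * x + d * y, h'⟩ : S8) * b0 =
        (⟨a, b, c, d, h⟩ : S8) * ⟨x, a * x + b * y, y, c * x + d * y, h'⟩ := by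
  decide +kernel

theorem conj_three (x : S8) (h : x ^ 3 = 1) (h1 : x ≠ 1) : ∃ g : S8, g * b0 * g⁻¹ = x := by
  obtain ⟨u, v, h', e⟩ := conj_three_aux x.a x.b x.c x.d x.h ((three_iff x).1 ⟨h, h1⟩)
  exact ⟨_, mul_inv_eq_iff_eq_mul.2 e⟩

theorem prod_three_aux : ∀ a b c d : K8, a * d + b * c = 1 → a ≠ d →
    ∃ x y z : K8, x * (x + 1) + y * z = 1 ∧
      c * y + d * x = (x + 1) * a + z * b + 1 := by
  decide +kernel

theorem prod_three (x : S8) (hx : x.a ≠ x.d) :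
    ∃ g k : S8, (g ^ 3 = 1 ∧ g ≠ 1) ∧ (k ^ 3 = 1 ∧ k ≠ 1) ∧ x = g * k := by
  obtain ⟨u, v, w, h, e⟩ := prod_three_aux x.a x.b x.c x.d x.h hx
  refine ⟨x * ⟨u, v, w, u + 1, h⟩⁻¹, ⟨u, v, w, u + 1, h⟩, ?_, ?_, by group⟩
  · rw [three_iff]
    change x.c * v + x.d * u = x.a * (u + 1) + x.b * w + 1
    linear_combination e
  · rw [three_iff]

theorem prod_trace_aux : ∀ a b c d : K8, a * d + b * c = 1 → a = d →
    ∃ x y z : K8, x * (x + 1) + y * z = 1 ∧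
      a * x + b * z ≠ c * y + d * (x + 1) := by
  decide +kernel

theorem mem_of_three (N : Subgroup S8) (hN : ∀ g : S8, g ^ 3 = 1 → g ≠ 1 → g ∈ N) (x : S8) :
    x ∈ N := by
  have key : ∀ y : S8, y.a ≠ y.d → y ∈ N := by
    intro y hy
    obtain ⟨g, k, hg, hk, rfl⟩ := prod_three y hy
    exact N.mul_mem (hN g hg.1 hg.2) (hN k hk.1 hk.2)
  by_cases hx : x.a = x.d
  · obtain ⟨u, v, w, h, e⟩ := prod_trace_aux x.a x.b x.c x.d x.h hx
    have h3 := (three_iff ⟨u, v, w, u + 1, h⟩).2 rfl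
    have h1 := key (x * ⟨u, v, w, u + 1, h⟩) e
    exact (N.mul_mem_cancel_right (hN _ h3.1 h3.2)).1 h1
  · exact key x hx

theorem eq_top_of_normal (N : Subgroup S8) [N.Normal] (g : S8) (hg : g ∈ N) (h3 : g ^ 3 = 1)
    (h1 : g ≠ 1) : N = ⊤ := by
  rw [Subgroup.eq_top_iff']
  refine mem_of_three N fun x hx hx1 => ?_
  obtain ⟨u, hu⟩ := conj_three g h3 h1
  obtain ⟨v, rfl⟩ := conj_three x hx hx1
  have : b0 = u⁻¹ * g * u⁻¹⁻¹ := by rw [← hu]; group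
  refine Subgroup.Normal.conj_mem ‹_› _ ?_ v
  rw [this]
  exact Subgroup.Normal.conj_mem ‹_› _ hg _

/-- Coordinates of the pairs `(a, b)` with `a² = b³ = (ab)⁷ = 1`, none of them trivial. -/
def pairs : Finset ((K8 × K8 × K8) × (K8 × K8 × K8)) :=
  (((Finset.univ : Finset (K8 × K8 × K8)).filter
      fun p => p.1 * p.1 + p.2.1 * p.2.2 = 1 ∧ ¬ (p.2.1 = 0 ∧ p.2.2 = 0)) ×ˢ
    ((Finset.univ : Finset (K8 × K8 × K8)).filter
      fun q => q.1 * (q.1 + 1) + q.2.1 * q.2.2 = 1)).filter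
    fun r => T7 ((r.1.1 * r.2.1 + r.1.2.1 * r.2.2.2) + (r.1.2.2 * r.2.2.1 + r.1.1 * (r.2.1 + 1)))

theorem mem_pairs (r : (K8 × K8 × K8) × (K8 × K8 × K8)) : r ∈ pairs ↔
    ((r.1.1 * r.1.1 + r.1.2.1 * r.1.2.2 = 1 ∧ ¬ (r.1.2.1 = 0 ∧ r.1.2.2 = 0)) ∧
      r.2.1 * (r.2.1 + 1) + r.2.2.1 * r.2.2.2 = 1) ∧
    T7 ((r.1.1 * r.2.1 + r.1.2.1 * r.2.2.2) + (r.1.2.2 * r.2.2.1 + r.1.1 * (r.2.1 + 1))) := by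
  rw [pairs, Finset.mem_filter, Finset.mem_product, Finset.mem_filter, Finset.mem_filter,
    and_iff_right (Finset.mem_univ _), and_iff_right (Finset.mem_univ _)]

theorem pairs_card : pairs.card = 1512 := by decide +kernel

attribute [irreducible] pairs

end S8

/-- `(2,3,7)`-pairs in a group. -/
def IsPair {G : Type*} [Group G] (p : G × G) : Prop :=
  (p.1 ^ 2 = 1 ∧ p.1 ≠ 1) ∧ (p.2 ^ 3 = 1 ∧ p.2 ≠ 1) ∧ ((p.1 * p.2) ^ 7 = 1 ∧ p.1 * p.2 ≠ 1)

namespace S8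

theorem isPair_iff (p : S8 × S8) : IsPair p ↔ (p.1.a = p.1.d ∧ ¬ (p.1.b = 0 ∧ p.1.c = 0)) ∧
    p.2.d = p.2.a + 1 ∧ T7 ((p.1 * p.2).a + (p.1 * p.2).d) := by
  rw [IsPair, inv_iff, three_iff, seven_iff]

def pairEquiv : {p : S8 × S8 // IsPair p} ≃ {r : (K8 × K8 × K8) × (K8 × K8 × K8) // r ∈ pairs} where
  toFun p := ⟨((p.1.1.a, p.1.1.b, p.1.1.c), (p.1.2.a, p.1.2.b, p.1.2.c)), by
    obtain ⟨⟨p, q⟩, h⟩ := p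
    obtain ⟨⟨h1, h2⟩, h3, h4⟩ := (isPair_iff _).1 h
    have e1 := p.h
    have e2 := q.h
    simp only [mul_def] at h1 h2 h3 h4
    rw [← h1] at e1 h4
    rw [h3] at e2 h4
    exact (mem_pairs _).2 ⟨⟨⟨e1, h2⟩, e2⟩, h4⟩⟩
  invFun r := ⟨(⟨r.1.1.1, r.1.1.2.1, r.1.1.2.2, r.1.1.1, by
      have := (mem_pairs _).1 r.2
      exact this.1.1.1⟩, ⟨r.1.2.1, r.1.2.2.1, r.1.2.2.2, r.1.2.1 + 1, by
      have := (mem_pairs _).1 r.2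
      exact this.1.2⟩), by
      have := (mem_pairs _).1 r.2
      rw [isPair_iff]
      exact ⟨⟨rfl, this.1.1.2⟩, rfl, this.2⟩⟩
  left_inv p := by
    obtain ⟨⟨p, q⟩, h⟩ := p
    obtain ⟨⟨h1, h2⟩, h3, h4⟩ := (isPair_iff _).1 h
    apply Subtype.ext
    apply Prod.ext
    · exact S8.ext rfl rfl rfl h1
    · exact S8.ext rfl rfl rfl h3.symm
  right_inv r := rfl

theorem card_pairs : Nat.card {p : S8 × S8 // IsPair p} = 1512 := by
  rw [Nat.card_congr pairEquiv, Nat.card_eq_fintype_card, Fintype.card_coe, pairs_card]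

theorem comm_aux : ∀ a b c d : K8, ∀ h : a * d + b * c = 1, a = d → ¬ (b = 0 ∧ c = 0) →
    let x : S8 := ⟨a, b, c, d, h⟩
    T7 ((x * b0).a + (x * b0).d) →
    (x * b0 * x⁻¹ * b0⁻¹) ^ 9 = 1 ∧ (x * b0 * x⁻¹ * b0⁻¹) ^ 3 ≠ 1 := by
  decide +kernel

theorem comm_nine (p : S8 × S8) (h : IsPair p) :
    (p.1 * p.2 * p.1⁻¹ * p.2⁻¹) ^ 9 = 1 ∧ (p.1 * p.2 * p.1⁻¹ * p.2⁻¹) ^ 3 ≠ 1 := by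
  obtain ⟨x, y⟩ := p
  obtain ⟨g, rfl⟩ := conj_three y h.2.1.1 h.2.1.2
  obtain ⟨z, rfl⟩ : ∃ z, x = g * z * g⁻¹ := ⟨g⁻¹ * x * g, by group⟩
  have hz : IsPair (z, b0) := by
    have e : g * z * g⁻¹ * (g * b0 * g⁻¹) = g * (z * b0) * g⁻¹ := by group
    unfold IsPair at h ⊢
    simp only [e, conj_pow, ne_eq, conj_eq_one_iff] at h
    exact h
  have e : g * z * g⁻¹ * (g * b0 * g⁻¹) * (g * z * g⁻¹)⁻¹ * (g * b0 * g⁻¹)⁻¹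
      = g * (z * b0 * z⁻¹ * b0⁻¹) * g⁻¹ := by group
  simp only [e, conj_pow, ne_eq, conj_eq_one_iff]
  obtain ⟨⟨h1, h2⟩, h3, h4⟩ := (isPair_iff _).1 hz
  exact comm_aux z.a z.b z.c z.d z.h h1 h2 h4

theorem exists_nine : ∃ g t : S8, g ^ 9 = 1 ∧ g ^ 3 ≠ 1 ∧ t ^ 2 = 1 ∧ t ≠ 1 ∧ t * g * t⁻¹ = g⁻¹ := by
  -- companion matrix and the swap
  refine ⟨⟨0, 1, 1, K8.mk 2, by decide +kernel⟩, ⟨0, 1, 1, 0, by decide +kernel⟩, ?_⟩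
  decide +kernel

theorem center_triv (z : S8) (hz : ∀ g, g * z = z * g) : z = 1 := by
  have h1 := hz ⟨1, 1, 0, 1, by decide +kernel⟩
  have h2 := hz ⟨1, 0, 1, 1, by decide +kernel⟩
  revert z
  rw [all_iff]
  have : ∀ a b c d : K8, ∀ h : a * d + b * c = 1, ∀ h1 : (⟨1, 1, 0, 1, by decide +kernel⟩ : S8) * ⟨a, b, c, d, h⟩ = ⟨a, b, c, d, h⟩ * ⟨1, 1, 0, 1, by decide +kernel⟩,
    ∀ h2 : (⟨1, 0, 1, 1, by decide +kernel⟩ : S8) * ⟨a, b, c, d, h⟩ = ⟨a, b, c, d, h⟩ * ⟨1, 0, 1, 1, by decide +kernel⟩, (⟨a, b, c, d, h⟩ : S8) = 1 := by decide +kernel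
  intro a b c d h _ h1 h2
  exact this a b c d h h1 h2

def toSL : S8 ≃* SpecialLinearGroup (Fin 2) K8 where
  toFun x := ⟨!![x.a, x.b; x.c, x.d], by
    rw [det_fin_two_of, sub_eq_add_neg, K8.neg_eq, x.h]⟩
  invFun A := ⟨A 0 0, A 0 1, A 1 0, A 1 1, by
    have := A.2
    rwa [det_fin_two, sub_eq_add_neg, K8.neg_eq] at this⟩
  left_inv x := by ext <;> rfl
  right_inv A := by
    ext i j
    fin_cases i <;> fin_cases j <;> rfl
  map_mul' x y := by
    apply Subtype.ext
    change _ = !![x.a, x.b; x.c, x.d] * !![y.a, y.b; y.c, y.d]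
    rw [mul_fin_two]
    rfl

noncomputable def toSLG : S8 ≃* SpecialLinearGroup (Fin 2) (GaloisField 2 3) :=
  toSL.trans (MulEquiv.ofBijective (SpecialLinearGroup.map (K8.iso : K8 →+* GaloisField 2 3)) (by
    constructor
    · intro A B h
      ext i j
      have := congrArg (fun M : SpecialLinearGroup (Fin 2) (GaloisField 2 3) => M i j) h
      exact K8.iso.injective this
    · intro B
      refine ⟨SpecialLinearGroup.map (K8.iso.symm : GaloisField 2 3 →+* K8) B, ?_⟩
      ext i j
      exact K8.iso.apply_symm_apply _))

theorem toSLG_center : Subgroup.center (SpecialLinearGroup (Fin 2) (GaloisField 2 3)) = ⊥ := by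
  rw [Subgroup.eq_bot_iff_forall]
  intro z hz
  rw [Subgroup.mem_center_iff] at hz
  have : toSLG.symm z = 1 := center_triv _ fun g => by
    have := congrArg toSLG.symm (hz (toSLG g))
    simpa using this
  simpa using this

noncomputable def toPSL : S8 ≃* ProjectiveSpecialLinearGroup (Fin 2) (GaloisField 2 3) :=
  toSLG.trans (MulEquiv.ofBijective (QuotientGroup.mk' _) ⟨by
    rw [← MonoidHom.ker_eq_bot_iff, QuotientGroup.ker_mk', toSLG_center],
    QuotientGroup.mk'_surjective _⟩)

end S8

theorem range_le {A : Type*} [Group A] (i : S8 →* A) (L : Subgroup A) (h0 : L.index ≠ 0)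
    (h9 : L.index < 9) : i.range ≤ L := by
  obtain ⟨g, t, hg9, hg3, -⟩ := S8.exists_nine
  have : L.FiniteIndex := ⟨h0⟩
  have : Finite (A ⧸ L) := inferInstance
  have key : ∀ x : A ⧸ L, (i g) ^ 3 • x = x := by
    intro x
    have hper : Function.IsPeriodicPt (fun y : A ⧸ L => i g • y) 9 x := by
      rw [Function.IsPeriodicPt, Function.IsFixedPt, smul_iterate]
      change (i g) ^ 9 • x = x
      rw [← map_pow, hg9, map_one, one_smul]
    have hd := hper.minimalPeriod_dvd
    have hle : Function.minimalPeriod (fun y : A ⧸ L => i g • y) x < 9 := by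
      have := Fintype.ofFinite (A ⧸ L)
      refine lt_of_le_of_lt ?_ h9
      rw [Subgroup.index_eq_card, Nat.card_eq_fintype_card]
      exact Function.minimalPeriod_le_card
    have h3 : Function.minimalPeriod (fun y : A ⧸ L => i g • y) x ∣ 3 := by
      have : ∀ m < 9, m ∣ 9 → m ∣ 3 := by decide
      exact this _ hle hd
    have := (Function.isPeriodicPt_iff_minimalPeriod_dvd.2 h3)
    rw [Function.IsPeriodicPt, Function.IsFixedPt, smul_iterate] at this
    exact this
  have hmem : g ^ 3 ∈ L.normalCore.comap i := by
    rw [Subgroup.mem_comap, Subgroup.normalCore_eq_ker, MonoidHom.mem_ker, map_pow]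
    ext x
    exact key x
  have htop := S8.eq_top_of_normal (L.normalCore.comap i) (g ^ 3) hmem
    (by rw [← pow_mul]; exact hg9) hg3
  rintro _ ⟨s, rfl⟩
  have : s ∈ L.normalCore.comap i := htop ▸ Subgroup.mem_top s
  exact L.normalCore_le this

theorem main_group {A : Type*} [Group A] [Finite A] (i : S8 →* A) (hi : Function.Injective i)
    [hn : i.range.Normal] (hc : Nat.card A ∣ 1512) (Q : Sylow 3 A) :
    ¬ IsCoatom (Q : Subgroup A) ∧ ∀ L : Subgroup A,
      (∃ p : ℕ, p.Prime ∧ (L.index = p ∨ L.index = p ^ 2)) → ¬ (Q : Subgroup A) ≤ L := by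
  have : Fact (Nat.Prime 3) := ⟨by norm_num⟩
  constructor
  · intro hco
    -- find an element of order 9 of the socle inside `Q`, inverted by an involution
    obtain ⟨g, t, hgQ, hg9, hg3, ht2, ht1, htg⟩ : ∃ g t : S8, i g ∈ Q ∧ g ^ 9 = 1 ∧ g ^ 3 ≠ 1 ∧
        t ^ 2 = 1 ∧ t ≠ 1 ∧ t * g * t⁻¹ = g⁻¹ := by
      obtain ⟨g, t, hg9, hg3, ht2, ht1, htg⟩ := S8.exists_nine
      have hp : IsPGroup 3 (Subgroup.zpowers (i g)) := by
        refine IsPGroup.of_card (n := 2) ?_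
        rw [Nat.card_zpowers, orderOf_injective i hi]
        exact orderOf_eq_prime_pow (p := 3) (n := 1) hg3 hg9
      obtain ⟨Q', hQ'⟩ := hp.exists_le_sylow
      obtain ⟨a, rfl⟩ := MulAction.exists_smul_eq A Q' Q
      obtain ⟨g', hg'⟩ : a * i g * a⁻¹ ∈ i.range := hn.conj_mem _ ⟨g, rfl⟩ a
      obtain ⟨t', ht'⟩ : a * i t * a⁻¹ ∈ i.range := hn.conj_mem _ ⟨t, rfl⟩ a
      refine ⟨g', t', ?_, ?_, ?_, ?_, ?_, ?_⟩
      · rw [hg']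
        have : i g ∈ Q' := hQ' (Subgroup.mem_zpowers _)
        exact Subgroup.smul_mem_pointwise_smul (i g) (MulAut.conj a) (Q' : Subgroup A) this
      · apply hi
        rw [map_pow, hg', conj_pow, ← map_pow, hg9]; simp
      · intro h
        have := congrArg i h
        rw [map_pow, hg', conj_pow, ← map_pow, map_one, conj_eq_one_iff] at this
        exact hg3 (hi (this.trans (map_one i).symm))
      · apply hi
        rw [map_pow, ht', conj_pow, ← map_pow, ht2]; simp
      · intro h
        have := congrArg i h
        rw [ht', map_one, conj_eq_one_iff] at this
        exact ht1 (hi (this.trans (map_one i).symm))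
      · apply hi
        have e := congrArg (fun s => a * i s * a⁻¹) htg
        simp only [map_mul, map_inv] at e
        rw [map_mul, map_mul, map_inv, map_inv, hg', ht']
        calc _ = a * (i t * i g * (i t)⁻¹) * a⁻¹ := by group
          _ = _ := by rw [e]; group
    have hord : orderOf g = 9 := orderOf_eq_prime_pow (p := 3) (n := 1) hg3 hg9
    -- the part of `Q` in the socle is generated by `g`
    set R : Subgroup S8 := (Q : Subgroup A).comap i with hR
    have hgR : g ∈ R := hgQ
    have hle : Subgroup.zpowers g ≤ R := by
      rw [Subgroup.zpowers_le]; exact hgR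
    have hRp : IsPGroup 3 R := Q.isPGroup'.comap_of_injective i hi
    have hRcard : Nat.card R ≤ 9 := by
      obtain ⟨n, hn⟩ := IsPGroup.iff_card.1 hRp
      have hd : Nat.card R ∣ 504 := S8.card ▸ Subgroup.card_subgroup_dvd_card R
      rw [hn] at hd ⊢
      by_contra hlt
      have h2 : 3 ≤ n := by
        by_contra h
        have : n = 0 ∨ n = 1 ∨ n = 2 := by omega
        rcases this with rfl | rfl | rfl <;> norm_num at hlt
      exact absurd ((pow_dvd_pow 3 h2).trans hd) (by norm_num)
    have hRz : Subgroup.zpowers g = R := by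
      apply Subgroup.eq_of_le_of_card_ge hle
      rw [Nat.card_zpowers, hord]
      exact hRcard
    have hRi : R.map i = (Q : Subgroup A) ⊓ i.range := by
      rw [hR, Subgroup.map_comap_eq, inf_comm]
    set M : Subgroup A := Subgroup.normalizer (R.map i : Subgroup A) with hM
    have hQM : (Q : Subgroup A) ≤ M := by
      intro x hx
      rw [hM, Subgroup.mem_normalizer_iff, hRi]
      intro y
      rw [Subgroup.mem_inf, Subgroup.mem_inf]
      refine and_congr ?_ ⟨fun h => hn.conj_mem y h x, fun h => by
        simpa [mul_assoc] using hn.conj_mem _ h x⁻¹⟩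
      have hx' : x⁻¹ ∈ (Q : Subgroup A) := inv_mem hx
      rw [Subgroup.mul_mem_cancel_right _ hx', Subgroup.mul_mem_cancel_left _ hx]
    have htM : i t ∈ M := by
      rw [hM, Subgroup.mem_normalizer_iff_map_conj_eq]
      have e : MulAut.conj (i t) (i g) = (i g)⁻¹ := by
        rw [MulAut.conj_apply, ← map_inv, ← map_mul, ← map_mul, htg, map_inv]
      rw [← hRz, MonoidHom.map_zpowers, MonoidHom.map_zpowers]
      exact (congrArg Subgroup.zpowers e).trans Subgroup.zpowers_inv
    rcases hco.le_iff.1 hQM with h | h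
    · have hnorm : (R.map i).Normal := Subgroup.normalizer_eq_top_iff.1 h
      have hRn : R.Normal := by
        have := hnorm.comap i
        rwa [Subgroup.comap_map_eq_self_of_injective hi] at this
      have := S8.eq_top_of_normal R (g ^ 3) (pow_mem hgR 3) (by rw [← pow_mul]; exact hg9) hg3
      rw [this, Subgroup.card_top, S8.card] at hRcard
      norm_num at hRcard
    · have htQ : i t ∈ (Q : Subgroup A) := h ▸ htM
      have htR : t ∈ R := htQ
      obtain ⟨n, hn⟩ := hRp ⟨t, htR⟩
      have hn' : t ^ 3 ^ n = 1 := congrArg Subtype.val hn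
      have h1 : orderOf t ∣ 3 ^ n := orderOf_dvd_of_pow_eq_one hn'
      rw [orderOf_eq_prime ht2 ht1] at h1
      have := Nat.prime_two.dvd_of_dvd_pow h1
      norm_num at this
  · rintro L ⟨p, hp, hL⟩ hQL
    have hLA : L.index ∣ 1512 := L.index_dvd_card.trans hc
    have h3 : ¬ 3 ∣ L.index := fun h => Q.not_dvd_index (h.trans (Subgroup.index_dvd_of_le hQL))
    have hpd : p ∣ 1512 := by
      rcases hL with h | h
      · exact h ▸ hLA
      · exact (Dvd.intro_left _ (by rw [h]; ring)).trans hLA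
    have hp' : p = 2 ∨ p = 3 ∨ p = 7 := by
      have : p ∣ 2 ^ 3 * 3 ^ 3 * 7 := hpd
      rcases (hp.dvd_mul).1 this with h | h
      · rcases (hp.dvd_mul).1 h with h | h
        · exact Or.inl ((Nat.prime_dvd_prime_iff_eq hp Nat.prime_two).1 (hp.dvd_of_dvd_pow h))
        · exact Or.inr (Or.inl ((Nat.prime_dvd_prime_iff_eq hp Nat.prime_three).1
            (hp.dvd_of_dvd_pow h)))
      · exact Or.inr (Or.inr ((Nat.prime_dvd_prime_iff_eq hp (by norm_num)).1 h))
    have hlt : L.index < 9 ∧ L.index ≠ 0 ∧ L.index ≠ 1 := by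
      rcases hp' with rfl | rfl | rfl <;> rcases hL with h | h <;> rw [h] at h3 hLA ⊢ <;>
        revert h3 hLA <;> decide
    have hr := range_le i L hlt.2.1 hlt.1
    have hcard : Nat.card i.range = 504 := by
      rw [← S8.card]
      exact (Nat.card_congr (MonoidHom.ofInjective hi).toEquiv).symm
    have hri : i.range.index ∣ 3 := by
      have := Subgroup.card_mul_index i.range
      rw [hcard] at this
      rw [← this] at hc
      exact Nat.dvd_of_mul_dvd_mul_left (by norm_num : 0 < 504) hc
    rcases (Nat.dvd_prime Nat.prime_three).1 ((Subgroup.index_dvd_of_le hr).trans hri) with h | h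
    · exact hlt.2.2 h
    · exact h3 (h ▸ dvd_rfl)


theorem pair_gen (p : S8 × S8) (h : IsPair p) (H : Subgroup S8) (h1 : p.1 ∈ H) (h2 : p.2 ∈ H) :
    H = ⊤ := by
  have o2 : orderOf p.1 = 2 := orderOf_eq_prime h.1.1 h.1.2
  have : Fact (Nat.Prime 3) := ⟨by norm_num⟩
  have : Fact (Nat.Prime 7) := ⟨by norm_num⟩
  have o7 : orderOf (p.1 * p.2) = 7 := orderOf_eq_prime h.2.2.1 h.2.2.2
  have hc := S8.comm_nine p h
  have o9 : orderOf (p.1 * p.2 * p.1⁻¹ * p.2⁻¹) = 9 :=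
    orderOf_eq_prime_pow (p := 3) (n := 1) hc.2 hc.1
  have d2 : 2 ∣ Nat.card H := o2 ▸ H.orderOf_dvd_natCard h1
  have d7 : 7 ∣ Nat.card H := o7 ▸ H.orderOf_dvd_natCard (H.mul_mem h1 h2)
  have d9 : 9 ∣ Nat.card H := o9 ▸ H.orderOf_dvd_natCard
    (H.mul_mem (H.mul_mem (H.mul_mem h1 h2) (H.inv_mem h1)) (H.inv_mem h2))
  have hm := H.card_mul_index
  rw [S8.card] at hm
  obtain ⟨k, hk⟩ : 126 ∣ Nat.card H := by omega
  have hi : k * H.index = 4 := by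
    rw [hk] at hm
    linarith
  have hd : H.index ∣ 4 := Dvd.intro_left _ hi
  have := range_le (MonoidHom.id S8) H (by rintro h; rw [h] at hi; omega)
    ((Nat.le_of_dvd (by norm_num) hd).trans_lt (by norm_num))
  rw [eq_top_iff]
  intro x _
  exact this ⟨x, rfl⟩

instance pairAction : MulAction (MulAut S8) {p : S8 × S8 // IsPair p} where
  smul f p := ⟨(f p.1.1, f p.1.2), by
    have h := p.2
    unfold IsPair at h ⊢
    simp only [← map_mul, ← map_pow, ne_eq, EmbeddingLike.map_eq_one_iff]
    exact h⟩
  one_smul _ := rfl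
  mul_smul _ _ _ := rfl

theorem stab_bot (p : {p : S8 × S8 // IsPair p}) : MulAction.stabilizer (MulAut S8) p = ⊥ := by
  rw [Subgroup.eq_bot_iff_forall]
  intro f hf
  have hf' : f • p = p := hf
  have e := congrArg Subtype.val hf'
  have e1 : f p.1.1 = p.1.1 := congrArg Prod.fst e
  have e2 : f p.1.2 = p.1.2 := congrArg Prod.snd e
  have := pair_gen p.1 p.2 (MonoidHom.eqLocus f.toMonoidHom (MonoidHom.id S8)) e1 e2
  ext x : 1
  have hx : x ∈ MonoidHom.eqLocus f.toMonoidHom (MonoidHom.id S8) := this ▸ Subgroup.mem_top x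
  exact hx

theorem card_aut : Nat.card (MulAut S8) ∣ 1512 := by
  rw [← S8.card_pairs,
    Nat.card_congr (MulAction.selfEquivSigmaOrbitsQuotientStabilizer (MulAut S8)
      {p : S8 × S8 // IsPair p})]
  have := Fintype.ofFinite (Quotient (MulAction.orbitRel (MulAut S8) {p : S8 × S8 // IsPair p}))
  rw [Nat.card_sigma]
  refine Finset.dvd_sum fun ω _ => ?_
  rw [← Subgroup.index_eq_card, stab_bot, Subgroup.index_bot]

theorem stmt_18 :
    (∀ Q : Sylow 3 PSL2_8,
      ¬ IsCoatom (Q : Subgroup PSL2_8) ∧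
        ∀ L : Subgroup PSL2_8,
          (∃ p : ℕ, p.Prime ∧ (L.index = p ∨ L.index = p ^ 2)) →
            ¬ (Q : Subgroup PSL2_8) ≤ L) ∧
    (∀ Q : Sylow 3 PGammaL2_8,
      ¬ IsCoatom (Q : Subgroup PGammaL2_8) ∧
        ∀ L : Subgroup PGammaL2_8,
          (∃ p : ℕ, p.Prime ∧ (L.index = p ∨ L.index = p ^ 2)) →
            ¬ (Q : Subgroup PGammaL2_8) ≤ L) := by
  have hfin : Finite PSL2_8 := Finite.of_equiv _ S8.toPSL.toEquiv
  constructor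
  · intro Q
    have hr : S8.toPSL.toMonoidHom.range = ⊤ :=
      MonoidHom.range_eq_top.2 S8.toPSL.surjective
    have : S8.toPSL.toMonoidHom.range.Normal := by rw [hr]; infer_instance
    refine main_group S8.toPSL.toMonoidHom S8.toPSL.injective ?_ Q
    rw [← Nat.card_congr S8.toPSL.toEquiv, S8.card]
    norm_num
  · intro Q
    have hr : ((MulAut.conj : PSL2_8 →* MulAut PSL2_8).comp S8.toPSL.toMonoidHom).range
        = (MulAut.conj : PSL2_8 →* MulAut PSL2_8).range := by
      rw [MonoidHom.range_comp, MonoidHom.range_eq_top.2 S8.toPSL.surjective,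
        MonoidHom.range_eq_map]
    have : ((MulAut.conj : PSL2_8 →* MulAut PSL2_8).comp S8.toPSL.toMonoidHom).range.Normal := by
      rw [hr]
      constructor
      rintro _ ⟨x, rfl⟩ f
      refine ⟨f x, ?_⟩
      ext y
      simp [MulAut.conj_apply]
    refine main_group ((MulAut.conj : PSL2_8 →* MulAut PSL2_8).comp S8.toPSL.toMonoidHom)
      ?_ ?_ Q
    · rw [injective_iff_map_eq_one]
      intro z hz
      refine S8.center_triv z fun g => S8.toPSL.injective ?_
      have := DFunLike.congr_fun hz (S8.toPSL g)
      have h2 : S8.toPSL z * S8.toPSL g * (S8.toPSL z)⁻¹ = S8.toPSL g := this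
      rw [map_mul, map_mul, ← mul_inv_eq_iff_eq_mul.1 h2]
    · rw [← Nat.card_congr (MulAut.congr S8.toPSL).toEquiv]
      exact card_aut
end
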